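/- arXiv:2005.11625 — 5 statements merged into one kernel-verified Lean document; each statement's English description precedes it below -/
import Mathlib

section
/- Let h1 > h2 > 0 be fixed. For each λ ∈ (0,1) and h > 0, let 𝓛_h^λ be the probability distribution on ℕ × ℕ of the pair (N1, N2) obtained as follows: sample M ∈ ℕ with P(M = m) = (1 − λ)λ^m; given M, let N1 and N2 be conditionally independent, each distributed as G + S_M(λ,h), where G has law q_{λ,h} and is independent of S_M(λ,h). Then limsup_{λ ↗ 1} ‖𝓛_{h1}^λ − 𝓛_{h2}^λ‖_TV < 1, where ‖·‖_TV denotes the total variation distance (1/2)Σ_{y∈ℕ²}|𝓛_{h1}^λ(y) − 𝓛_{h2}^λ(y)|. -/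
open Set Filter MeasureTheory

/-- Extinction-type parameter of the TKF91 model (deletion rate 1, insertion rate `lam`). -/
noncomputable def eta (lam t : ℝ) : ℝ :=
  (1 - Real.exp (-(1 - lam) * t)) / (1 - lam * Real.exp (-(1 - lam) * t))

/-- TKF91 mortal-link progeny-length pmf `p_{λ,t}`. -/
noncomputable def pTKF (lam t : ℝ) : ℕ → ℝ
  | 0 => eta lam t
  | (n + 1) => (1 - eta lam t) * (1 - lam * eta lam t) * (lam * eta lam t) ^ n

/-- TKF91 immortal-link progeny pmf `q_{λ,t}`. -/
noncomputable def qTKF (lam t : ℝ) (n : ℕ) : ℝ :=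
  (1 - lam * eta lam t) * (lam * eta lam t) ^ n

/-- pmf of `S_M(λ,t)`, a sum of `M` i.i.d. variables with law `p_{λ,t}`
(`M`-fold convolution of `pTKF lam t`). -/
noncomputable def pS (lam t : ℝ) : ℕ → ℕ → ℝ
  | 0 => fun n => if n = 0 then 1 else 0
  | (M + 1) => fun n => ∑ k ∈ Finset.range (n + 1), pS lam t M k * pTKF lam t (n - k)

/-- pmf of the leaf sequence length `N = G + S_M(λ,t)` with `G ~ q_{λ,t}` independent. -/
noncomputable def pLeaf (lam t : ℝ) (M n : ℕ) : ℝ :=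
  ∑ k ∈ Finset.range (n + 1), qTKF lam t k * pS lam t M (n - k)

/-- Joint distribution on `ℕ × ℕ` of the pair of leaf lengths of the two-leaf star tree
of height `h`, with stationary geometric root length. -/
noncomputable def Ldist (lam h : ℝ) (y : ℕ × ℕ) : ℝ :=
  ∑' M : ℕ, (1 - lam) * lam ^ M * (pLeaf lam h M y.1 * pLeaf lam h M y.2)

/-- Mean of `p_{λ,t}`. -/
noncomputable def betaTKF (lam t : ℝ) : ℝ := Real.exp (-(1 - lam) * t)

/-- Standard deviation of `p_{λ,t}`. -/
noncomputable def sdev (lam t : ℝ) : ℝ :=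
  Real.sqrt (∑' n : ℕ, ((n : ℝ) - betaTKF lam t) ^ 2 * pTKF lam t n)

/-- `P(S_M(λ,t) ∈ (a,b))`. -/
noncomputable def probIn (lam t : ℝ) (M : ℕ) (a b : ℝ) : ℝ :=
  ∑' j : ℕ, if (j : ℝ) ∈ Set.Ioo a b then pS lam t M j else 0

/-- CDF of `S_M(λ,t)`. -/
noncomputable def cdfS (lam t : ℝ) (M : ℕ) (x : ℝ) : ℝ :=
  ∑' j : ℕ, if (j : ℝ) ≤ x then pS lam t M j else 0

/-- Standard normal CDF. -/
noncomputable def stdNormalCDF (x : ℝ) : ℝ :=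
  ∫ u in Set.Iic x, Real.exp (-u ^ 2 / 2) / Real.sqrt (2 * Real.pi)

set_option linter.unusedVariables false

open Finset in
theorem conv_sum_le (f g : ℕ → ℝ) (hf : ∀ n, 0 ≤ f n) (hg : ∀ n, 0 ≤ g n)
    (hf1 : ∀ N, ∑ n ∈ range N, f n ≤ 1) (hg1 : ∀ N, ∑ n ∈ range N, g n ≤ 1) (N : ℕ) :
    ∑ n ∈ range N, ∑ k ∈ range (n + 1), f k * g (n - k) ≤ 1 := by
  rw [Finset.sum_range_diag_flip N (fun a b => f a * g b)]
  calc ∑ m ∈ range N, ∑ k ∈ range (N - m), f m * g k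
      = ∑ m ∈ range N, f m * ∑ k ∈ range (N - m), g k := by simp [mul_sum]
    _ ≤ ∑ m ∈ range N, f m := sum_le_sum fun m _ =>
        mul_le_of_le_one_right (hf m) (hg1 _)
    _ ≤ 1 := hf1 N

section basic
variable {lam t : ℝ}

theorem qTKF_nonneg (hl0 : 0 < lam) (hl : lam < 1) (h0 : 0 < eta lam t) (h1 : eta lam t < 1) (n : ℕ) :
    0 ≤ qTKF lam t n := by
  unfold qTKF
  have : lam * eta lam t < 1 := by nlinarith
  have : 0 ≤ 1 - lam * eta lam t := by linarith
  positivity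

theorem pTKF_nonneg (hl0 : 0 < lam) (hl : lam < 1) (h0 : 0 < eta lam t) (h1 : eta lam t < 1) (n : ℕ) :
    0 ≤ pTKF lam t n := by
  cases n with
  | zero => exact h0.le
  | succ n =>
    have := qTKF_nonneg hl0 hl h0 h1 n
    simp only [pTKF, mul_assoc]
    exact mul_nonneg (by linarith) this

theorem qTKF_sum (hl0 : 0 < lam) (hl : lam < 1) (h0 : 0 < eta lam t) (h1 : eta lam t < 1) (N : ℕ) :
    ∑ n ∈ Finset.range N, qTKF lam t n ≤ 1 := by
  simp only [qTKF]
  rw [← Finset.mul_sum]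
  have h := geom_sum_mul (lam * eta lam t) N
  have : 0 ≤ (lam * eta lam t) ^ N := by positivity
  linarith

theorem pTKF_sum (hl0 : 0 < lam) (hl : lam < 1) (h0 : 0 < eta lam t) (h1 : eta lam t < 1) (N : ℕ) :
    ∑ n ∈ Finset.range N, pTKF lam t n ≤ 1 := by
  cases N with
  | zero => simp
  | succ N =>
    rw [Finset.sum_range_succ']
    have h := qTKF_sum hl0 hl h0 h1 N
    have e : ∑ k ∈ Finset.range N, pTKF lam t (k + 1)
        = (1 - eta lam t) * ∑ k ∈ Finset.range N, qTKF lam t k := by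
      rw [Finset.mul_sum]
      refine Finset.sum_congr rfl fun k _ => ?_
      simp only [pTKF, qTKF, mul_assoc]
    rw [e]
    simp only [pTKF]
    nlinarith

theorem pS_nonneg (hl0 : 0 < lam) (hl : lam < 1) (h0 : 0 < eta lam t) (h1 : eta lam t < 1) (M n : ℕ) :
    0 ≤ pS lam t M n := by
  induction M generalizing n with
  | zero => simp only [pS]; split_ifs <;> norm_num
  | succ M ih =>
    simp only [pS]
    exact Finset.sum_nonneg fun k _ => mul_nonneg (ih k) (pTKF_nonneg hl0 hl h0 h1 _)

theorem pS_sum (hl0 : 0 < lam) (hl : lam < 1) (h0 : 0 < eta lam t) (h1 : eta lam t < 1) (M N : ℕ) :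
    ∑ n ∈ Finset.range N, pS lam t M n ≤ 1 := by
  induction M generalizing N with
  | zero => simp only [pS, Finset.sum_ite_eq']; split_ifs <;> norm_num
  | succ M ih =>
    simp only [pS]
    exact conv_sum_le _ _ (pS_nonneg hl0 hl h0 h1 M) (pTKF_nonneg hl0 hl h0 h1) ih
      (pTKF_sum hl0 hl h0 h1) N

theorem pLeaf_nonneg (hl0 : 0 < lam) (hl : lam < 1) (h0 : 0 < eta lam t) (h1 : eta lam t < 1)
    (M n : ℕ) : 0 ≤ pLeaf lam t M n :=
  Finset.sum_nonneg fun k _ =>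
    mul_nonneg (qTKF_nonneg hl0 hl h0 h1 k) (pS_nonneg hl0 hl h0 h1 _ _)

theorem pLeaf_sum (hl0 : 0 < lam) (hl : lam < 1) (h0 : 0 < eta lam t) (h1 : eta lam t < 1)
    (M N : ℕ) : ∑ n ∈ Finset.range N, pLeaf lam t M n ≤ 1 := by
  simp only [pLeaf]
  exact conv_sum_le _ _ (qTKF_nonneg hl0 hl h0 h1) (pS_nonneg hl0 hl h0 h1 M)
    (qTKF_sum hl0 hl h0 h1) (pS_sum hl0 hl h0 h1 M) N

theorem pLeaf_le_one (hl0 : 0 < lam) (hl : lam < 1) (h0 : 0 < eta lam t) (h1 : eta lam t < 1)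
    (M n : ℕ) : pLeaf lam t M n ≤ 1 :=
  le_trans (Finset.single_le_sum (f := fun n => pLeaf lam t M n)
    (fun i _ => pLeaf_nonneg hl0 hl h0 h1 M i)
    (Finset.self_mem_range_succ n)) (pLeaf_sum hl0 hl h0 h1 M (n + 1))

theorem Lterm_nonneg (hl0 : 0 < lam) (hl : lam < 1) (h0 : 0 < eta lam t) (h1 : eta lam t < 1)
    (y : ℕ × ℕ) (M : ℕ) :
    0 ≤ (1 - lam) * lam ^ M * (pLeaf lam t M y.1 * pLeaf lam t M y.2) := by
  have : 0 < 1 - lam := by linarith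
  have a := pLeaf_nonneg hl0 hl h0 h1 M y.1
  have b := pLeaf_nonneg hl0 hl h0 h1 M y.2
  positivity

theorem geo_summable (hl0 : 0 < lam) (hl : lam < 1) :
    HasSum (fun M : ℕ => (1 - lam) * lam ^ M) 1 := by
  have := (hasSum_geometric_of_lt_one hl0.le hl).mul_left (1 - lam)
  rwa [mul_inv_cancel₀ (by linarith)] at this

theorem Lterm_summable (hl0 : 0 < lam) (hl : lam < 1) (h0 : 0 < eta lam t) (h1 : eta lam t < 1)
    (y : ℕ × ℕ) :
    Summable fun M : ℕ => (1 - lam) * lam ^ M * (pLeaf lam t M y.1 * pLeaf lam t M y.2) := by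
  refine Summable.of_nonneg_of_le (Lterm_nonneg hl0 hl h0 h1 y) (fun M => ?_)
    (geo_summable hl0 hl).summable
  have : 0 < 1 - lam := by linarith
  refine mul_le_of_le_one_right (by positivity) ?_
  exact mul_le_one₀ (pLeaf_le_one hl0 hl h0 h1 _ _) (pLeaf_nonneg hl0 hl h0 h1 _ _)
    (pLeaf_le_one hl0 hl h0 h1 _ _)

theorem Ldist_nonneg (hl0 : 0 < lam) (hl : lam < 1) (h0 : 0 < eta lam t) (h1 : eta lam t < 1)
    (y : ℕ × ℕ) : 0 ≤ Ldist lam t y :=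
  tsum_nonneg (Lterm_nonneg hl0 hl h0 h1 y)

theorem Ldist_sum (hl0 : 0 < lam) (hl : lam < 1) (h0 : 0 < eta lam t) (h1 : eta lam t < 1)
    (s : Finset (ℕ × ℕ)) : ∑ y ∈ s, Ldist lam t y ≤ 1 := by
  obtain ⟨N, hN⟩ : ∃ N, s ⊆ Finset.range N ×ˢ Finset.range N := by
    obtain ⟨A, hA⟩ := (s.image Prod.fst).exists_nat_subset_range
    obtain ⟨B, hB⟩ := (s.image Prod.snd).exists_nat_subset_range
    refine ⟨max A B, fun y hy => ?_⟩
    have a := hA (Finset.mem_image_of_mem _ hy)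
    have b := hB (Finset.mem_image_of_mem _ hy)
    simp only [Finset.mem_range, Finset.mem_product] at a b ⊢
    omega
  refine (Finset.sum_le_sum_of_subset_of_nonneg hN
    fun y _ _ => Ldist_nonneg hl0 hl h0 h1 y).trans ?_
  simp only [Ldist]
  rw [← Summable.tsum_finsetSum fun y _ => Lterm_summable hl0 hl h0 h1 y]
  refine le_trans (Summable.tsum_le_tsum (fun M => ?_)
    (summable_sum fun y _ => Lterm_summable hl0 hl h0 h1 y) (geo_summable hl0 hl).summable)
    (geo_summable hl0 hl).tsum_eq.le
  rw [← Finset.mul_sum, Finset.sum_product, ← Finset.sum_mul_sum]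
  have : 0 < 1 - lam := by linarith
  refine mul_le_of_le_one_right (by positivity) ?_
  exact mul_le_one₀ (pLeaf_sum hl0 hl h0 h1 _ _)
    (Finset.sum_nonneg fun n _ => pLeaf_nonneg hl0 hl h0 h1 _ n) (pLeaf_sum hl0 hl h0 h1 _ _)

end basic

/-- Binomial pmf. -/
noncomputable def binp (n : ℕ) (p : ℝ) (k : ℕ) : ℝ := (n.choose k : ℝ) * p ^ k * (1 - p) ^ (n - k)

theorem pS_ps (lam t : ℝ) (M : ℕ) :
    PowerSeries.mk (pS lam t M) = (PowerSeries.mk (pTKF lam t)) ^ M := by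
  induction M with
  | zero => ext n; simp [pS, PowerSeries.coeff_one]
  | succ M ih =>
    rw [pow_succ, ← ih]
    ext n
    rw [PowerSeries.coeff_mul, PowerSeries.coeff_mk]
    simp only [PowerSeries.coeff_mk, pS]
    rw [Finset.Nat.sum_antidiagonal_eq_sum_range_succ
      (fun i j => pS lam t M i * pTKF lam t j)]

theorem q_ps (lam t : ℝ) (j : ℕ) :
    (PowerSeries.mk (qTKF lam t)) ^ (j + 1) =
      PowerSeries.C ((1 - lam * eta lam t) ^ (j + 1)) *
        PowerSeries.rescale (lam * eta lam t)
          (PowerSeries.mk fun n => ((j + n).choose j : ℝ)) := by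
  have : PowerSeries.mk (qTKF lam t) = PowerSeries.C (1 - lam * eta lam t) *
      PowerSeries.rescale (lam * eta lam t) (PowerSeries.mk 1) := by
    ext n
    rw [PowerSeries.coeff_C_mul, PowerSeries.coeff_rescale]
    simp [qTKF]
  rw [this, mul_pow, ← map_pow, ← map_pow, PowerSeries.mk_one_pow_eq_mk_choose_add]

theorem p_ps (lam t : ℝ) :
    PowerSeries.mk (pTKF lam t) = PowerSeries.X * PowerSeries.mk (qTKF lam t) *
      PowerSeries.C (1 - eta lam t) + PowerSeries.C (eta lam t) := by
  ext n
  cases n with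
  | zero => simp [pTKF]
  | succ n =>
    rw [mul_assoc, map_add, PowerSeries.coeff_succ_X_mul, PowerSeries.coeff_mul_C,
      PowerSeries.coeff_C]
    simp only [pTKF, qTKF, PowerSeries.coeff_mk, Nat.add_eq_zero_iff, one_ne_zero, and_false,
      if_false, add_zero]
    ring

theorem pLeaf_eq (lam t : ℝ) (M n : ℕ) :
    pLeaf lam t M n = ∑ j ∈ Finset.range (M + 1),
      (1 - lam * eta lam t) * (binp M (1 - eta lam t) j * binp n (1 - lam * eta lam t) j) := by
  have h : pLeaf lam t M n = PowerSeries.coeff n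
      (PowerSeries.mk (qTKF lam t) * PowerSeries.mk (pS lam t M)) := by
    rw [PowerSeries.coeff_mul]
    simp only [PowerSeries.coeff_mk, pLeaf]
    rw [Finset.Nat.sum_antidiagonal_eq_sum_range_succ
      (fun i j => qTKF lam t i * pS lam t M j)]
  rw [h, pS_ps, p_ps, add_pow, Finset.mul_sum, map_sum]
  refine Finset.sum_congr rfl fun j hj => ?_
  have e : PowerSeries.mk (qTKF lam t) *
      ((PowerSeries.X * PowerSeries.mk (qTKF lam t) * PowerSeries.C (1 - eta lam t)) ^ j *
        PowerSeries.C (eta lam t) ^ (M - j) * ((M.choose j : ℕ) : PowerSeries ℝ)) =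
      PowerSeries.C ((1 - eta lam t) ^ j * eta lam t ^ (M - j) * (M.choose j : ℝ)) *
        (PowerSeries.X ^ j * (PowerSeries.mk (qTKF lam t)) ^ (j + 1)) := by
    simp only [map_mul, map_pow, map_natCast]
    ring
  rw [e, q_ps, PowerSeries.coeff_C_mul, PowerSeries.coeff_X_pow_mul']
  unfold binp
  split_ifs with hjn
  · rw [PowerSeries.coeff_C_mul, PowerSeries.coeff_rescale, PowerSeries.coeff_mk]
    rw [Nat.add_sub_cancel' hjn, sub_sub_cancel, sub_sub_cancel]
    ring
  · rw [Nat.choose_eq_zero_of_lt (by omega : n < j)]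
    simp

theorem binp_nonneg {n : ℕ} {p : ℝ} (h0 : 0 ≤ p) (h1 : p ≤ 1) (k : ℕ) : 0 ≤ binp n p k := by
  have : 0 ≤ 1 - p := by linarith
  unfold binp; positivity

theorem binp_sum (n : ℕ) (p : ℝ) : ∑ k ∈ Finset.range (n + 1), binp n p k = 1 := by
  have h := congrArg (Polynomial.eval p) (bernsteinPolynomial.sum ℝ n)
  rw [Polynomial.eval_finsetSum] at h
  simpa [bernsteinPolynomial, binp] using h

theorem binp_var (n : ℕ) (p : ℝ) :
    ∑ k ∈ Finset.range (n + 1), ((n : ℝ) * p - k) ^ 2 * binp n p k = n * p * (1 - p) := by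
  have h := congrArg (Polynomial.eval p) (bernsteinPolynomial.variance ℝ n)
  rw [Polynomial.eval_finsetSum] at h
  simpa [bernsteinPolynomial, binp] using h

theorem binp_symm {n k : ℕ} (p : ℝ) (hk : k ≤ n) : binp n p k = binp n (1 - p) (n - k) := by
  unfold binp
  rw [Nat.choose_symm hk, Nat.sub_sub_self hk, sub_sub_cancel]
  ring

theorem binp_rec {n k : ℕ} (p : ℝ) (hk : k < n) :
    binp n p k * (((n : ℝ) - k) * p) = binp n p (k + 1) * (((k : ℝ) + 1) * (1 - p)) := by
  unfold binp
  have h := Nat.choose_succ_right_eq n k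
  have h' : (n.choose (k + 1) : ℝ) * (k + 1) = n.choose k * ((n : ℝ) - k) := by
    rw [← Nat.cast_sub hk.le]; exact_mod_cast h
  have e : n - k = (n - (k + 1)) + 1 := by omega
  rw [e, pow_succ, pow_succ]
  linear_combination (-(p ^ k * p * (1 - p) ^ (n - (k + 1)) * (1 - p))) * h'

theorem binp_step {n k : ℕ} {p d m : ℝ} (hd : 0 < d) (hp0 : d ≤ p) (hp1 : p ≤ 1 - d)
    (hm : 1 ≤ m) (hmd : 24 ≤ d * m) (hn : m ^ 2 ≤ n) (hk : |(k : ℝ) - n * p| ≤ 6 * m) :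
    k < n ∧ binp n p k ≤ Real.exp (28 / (d * m)) * binp n p (k + 1) := by
  obtain ⟨hk1, hk2⟩ := abs_le.mp hk
  have hpp : d / 2 ≤ p * (1 - p) := by nlinarith
  have hnp : m ^ 2 * (d / 2) ≤ n * (p * (1 - p)) :=
    mul_le_mul hn hpp (by positivity) (by positivity)
  have hD : m ^ 2 * d / 4 ≤ ((n : ℝ) - k) * p := by
    have e : ((n : ℝ) - k) * p = n * (p * (1 - p)) - ((k : ℝ) - n * p) * p := by ring
    have : ((k : ℝ) - n * p) * p ≤ 6 * m := by nlinarith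
    rw [e]; nlinarith
  have hDpos : 0 < ((n : ℝ) - k) * p := lt_of_lt_of_le (by positivity) hD
  have hkn : k < n := by
    have : 0 < (n : ℝ) - k := by
      by_contra hc
      push Not at hc
      nlinarith
    exact_mod_cast sub_pos.mp this
  refine ⟨hkn, ?_⟩
  have hrec := binp_rec p hkn
  have hb := binp_nonneg (n := n) (p := p) (by linarith) (by linarith) (k + 1)
  set D := ((n : ℝ) - k) * p with hDdef
  have h1 : ((k : ℝ) + 1) * (1 - p) ≤ D + 7 * m := by
    have : ((k : ℝ) + 1) * (1 - p) = D + ((k : ℝ) - n * p) + (1 - p) := by rw [hDdef]; ring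
    rw [this]; linarith
  have h2 : 7 * m ≤ D * (28 / (d * m)) := by
    have : 7 * m = (m ^ 2 * d / 4) * (28 / (d * m)) := by field_simp; ring
    rw [this]
    exact mul_le_mul_of_nonneg_right hD (by positivity)
  have h3 : ((k : ℝ) + 1) * (1 - p) ≤ D * Real.exp (28 / (d * m)) := by
    have := Real.add_one_le_exp (28 / (d * m))
    nlinarith
  have h4 : binp n p k * D ≤ (Real.exp (28 / (d * m)) * binp n p (k + 1)) * D := by
    rw [hrec]; nlinarith
  exact le_of_mul_le_mul_right h4 hDpos

theorem binp_chain {n k : ℕ} {p d m : ℝ} (hd : 0 < d) (hp0 : d ≤ p) (hp1 : p ≤ 1 - d)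
    (hm : 1 ≤ m) (hmd : 24 ≤ d * m) (hn : m ^ 2 ≤ n) (hk : |(k : ℝ) - n * p| ≤ 6 * m) (i : ℕ)
    (hi : |((k + i : ℕ) : ℝ) - n * p| ≤ 6 * m) :
    binp n p k ≤ Real.exp (28 / (d * m)) ^ i * binp n p (k + i) := by
  induction i with
  | zero => simp
  | succ i ih =>
    have hi' : |((k + i : ℕ) : ℝ) - n * p| ≤ 6 * m := by
      rw [abs_le] at hk hi ⊢
      push_cast at hk hi ⊢
      have : (0 : ℝ) ≤ i := by positivity
      constructor <;> linarith [hk.1, hk.2, hi.1, hi.2]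
    have h1 := ih hi'
    have h2 := (binp_step hd hp0 hp1 hm hmd hn hi').2
    rw [pow_succ, mul_assoc]
    exact h1.trans (mul_le_mul_of_nonneg_left h2 (by positivity))

theorem binp_peak {n : ℕ} {p m : ℝ} (hp0 : 0 ≤ p) (hp1 : p ≤ 1)
    (hm : 1 ≤ m) (hn : (n : ℝ) ≤ 4 * m ^ 2) :
    ∃ k : ℕ, |(k : ℝ) - n * p| ≤ 2 * m ∧ 1 / (10 * m) ≤ binp n p k := by
  by_contra hc
  push Not at hc
  set s := (Finset.range (n + 1)).filter fun k : ℕ => |(k : ℝ) - n * p| ≤ 2 * m with hs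
  have hnp : 0 ≤ (n : ℝ) * p := by positivity
  have hcard : (s.card : ℝ) ≤ 5 * m := by
    have hsub : s ⊆ Finset.Icc ⌈(n : ℝ) * p - 2 * m⌉₊ ⌊(n : ℝ) * p + 2 * m⌋₊ := by
      intro k hk
      rw [hs, Finset.mem_filter, abs_le] at hk
      rw [Finset.mem_Icc]
      exact ⟨Nat.ceil_le.mpr (by linarith [hk.2.1]), Nat.le_floor (by linarith [hk.2.2])⟩
    have h1 := Finset.card_le_card hsub
    rw [Nat.card_Icc] at h1
    have h2 := Nat.le_ceil ((n : ℝ) * p - 2 * m)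
    have h3 := Nat.floor_le (by linarith : 0 ≤ (n : ℝ) * p + 2 * m)
    have h4 : s.card = 0 ∨ s.card + ⌈(n : ℝ) * p - 2 * m⌉₊ ≤ ⌊(n : ℝ) * p + 2 * m⌋₊ + 1 := by
      omega
    rcases h4 with h4 | h4
    · rw [h4]; push_cast; linarith
    · have h5 : (s.card : ℝ) + (⌈(n : ℝ) * p - 2 * m⌉₊ : ℝ) ≤ (⌊(n : ℝ) * p + 2 * m⌋₊ : ℝ) + 1 := by
        exact_mod_cast h4
      linarith
  have hpt : ∀ k ∈ Finset.range (n + 1), binp n p k ≤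
      (if |(k : ℝ) - n * p| ≤ 2 * m then 1 / (10 * m) else 0) +
        ((n : ℝ) * p - k) ^ 2 * binp n p k * (1 / (4 * m ^ 2)) := by
    intro k _
    have hb := binp_nonneg (n := n) hp0 hp1 k
    split_ifs with h
    · have := (hc k h).le
      have : 0 ≤ ((n : ℝ) * p - k) ^ 2 * binp n p k * (1 / (4 * m ^ 2)) := by positivity
      linarith
    · push Not at h
      have h1 : 4 * m ^ 2 ≤ ((n : ℝ) * p - k) ^ 2 := by
        have : ((n : ℝ) * p - k) ^ 2 = |(k : ℝ) - n * p| ^ 2 := by rw [sq_abs]; ring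
        rw [this]; nlinarith
      have h2 : 1 ≤ ((n : ℝ) * p - k) ^ 2 * (1 / (4 * m ^ 2)) := by
        rw [mul_one_div, le_div_iff₀ (by positivity)]; linarith
      nlinarith
  have hsum := Finset.sum_le_sum hpt
  rw [binp_sum, Finset.sum_add_distrib, ← Finset.sum_mul, binp_var, ← Finset.sum_filter,
    Finset.sum_const, nsmul_eq_mul, ← hs] at hsum
  have h1 : (s.card : ℝ) * (1 / (10 * m)) ≤ 1 / 2 := by
    rw [mul_one_div, div_le_iff₀ (by positivity)]; linarith
  have h2 : (n : ℝ) * p * (1 - p) * (1 / (4 * m ^ 2)) ≤ 1 / 4 := by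
    rw [mul_one_div, div_le_iff₀ (by positivity)]
    have : p * (1 - p) ≤ 1 / 4 := by nlinarith [sq_nonneg (p - 1 / 2)]
    have : (n : ℝ) * (p * (1 - p)) ≤ n * (1 / 4) := mul_le_mul_of_nonneg_left this (by positivity)
    nlinarith
  linarith

/-- Local lower bound for the binomial pmf. -/
theorem binp_local {n j : ℕ} {p d m : ℝ} (hd : 0 < d) (hp0 : d ≤ p) (hp1 : p ≤ 1 - d)
    (hm : 1 ≤ m) (hmd : 24 ≤ d * m) (hn : m ^ 2 ≤ n) (hn' : (n : ℝ) ≤ 4 * m ^ 2)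
    (hj : |(j : ℝ) - n * p| ≤ 6 * m) :
    Real.exp (-(224 / d)) / 10 / m ≤ binp n p j := by
  obtain ⟨k, hk, hkb⟩ := binp_peak (n := n) (p := p) (by linarith) (by linarith) hm hn'
  have hk6 : |(k : ℝ) - n * p| ≤ 6 * m := by linarith
  have key : ∃ i : ℕ, (i : ℝ) ≤ 8 * m ∧
      binp n p k ≤ Real.exp (28 / (d * m)) ^ i * binp n p j := by
    rcases le_total k j with h | h
    · obtain ⟨i, rfl⟩ := Nat.exists_eq_add_of_le h
      refine ⟨i, ?_, binp_chain hd hp0 hp1 hm hmd hn hk6 i hj⟩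
      rw [abs_le] at hk hj
      push_cast at hj
      linarith [hk.1, hj.2]
    · obtain ⟨i, rfl⟩ := Nat.exists_eq_add_of_le h
      have hjn := (binp_step hd hp0 hp1 hm hmd hn hj).1.le
      have hkn := (binp_step hd hp0 hp1 hm hmd hn hk6).1.le
      refine ⟨i, ?_, ?_⟩
      · rw [abs_le] at hk hj
        push_cast at hk
        linarith [hk.2, hj.1]
      · rw [binp_symm p hkn, binp_symm p hjn]
        have e : n - j = (n - (j + i)) + i := by omega
        have hA : |((n - (j + i) : ℕ) : ℝ) - n * (1 - p)| ≤ 6 * m := by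
          rw [Nat.cast_sub hkn, ← abs_neg]
          convert hk6 using 2
          ring
        have hB : |((n - (j + i) + i : ℕ) : ℝ) - n * (1 - p)| ≤ 6 * m := by
          rw [← e, Nat.cast_sub hjn, ← abs_neg]
          convert hj using 2
          ring
        rw [e]
        exact binp_chain hd (by linarith) (by linarith) hm hmd hn hA i hB
  obtain ⟨i, hi, hb⟩ := key
  have hbj := binp_nonneg (n := n) (p := p) (by linarith) (by linarith) j
  have hE : Real.exp (28 / (d * m)) ^ i ≤ Real.exp (224 / d) := by
    rw [← Real.exp_nat_mul, Real.exp_le_exp]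
    calc (i : ℝ) * (28 / (d * m)) ≤ (8 * m) * (28 / (d * m)) := by gcongr
      _ = 224 / d := by field_simp; norm_num
  have h1 : 1 / (10 * m) ≤ Real.exp (224 / d) * binp n p j :=
    hkb.trans (hb.trans (mul_le_mul_of_nonneg_right hE hbj))
  rw [Real.exp_neg]
  have hpos := Real.exp_pos (224 / d)
  calc (Real.exp (224 / d))⁻¹ / 10 / m = (Real.exp (224 / d))⁻¹ * (1 / (10 * m)) := by
        field_simp
    _ ≤ (Real.exp (224 / d))⁻¹ * (Real.exp (224 / d) * binp n p j) := by gcongr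
    _ = binp n p j := by field_simp

theorem pLeaf_lower {lam t d : ℝ} {m M n : ℕ} (hl0 : 0 < lam) (hl : lam < 1) (hd : 0 < d)
    (hd1 : d ≤ lam * eta lam t) (hd2 : eta lam t ≤ 1 - d) (hm : 1 ≤ m) (hmd : 24 ≤ d * m)
    (hlm : (1 - lam) * (m : ℝ) ^ 2 ≤ 1) (hM : m ^ 2 ≤ M) (hM' : M ≤ 4 * m ^ 2)
    (hn : m ^ 2 ≤ n) (hn' : n ≤ 4 * m ^ 2) (h1 : M ≤ n + m) (h2 : n ≤ M + m) :
    d * (Real.exp (-(224 / d)) / 10) ^ 2 / m ≤ pLeaf lam t M n := by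
  have hmR : (1 : ℝ) ≤ m := by exact_mod_cast hm
  have hMR : (m : ℝ) ^ 2 ≤ M := by exact_mod_cast hM
  have hMR' : (M : ℝ) ≤ 4 * (m : ℝ) ^ 2 := by exact_mod_cast hM'
  have hnR : (m : ℝ) ^ 2 ≤ n := by exact_mod_cast hn
  have hnR' : (n : ℝ) ≤ 4 * (m : ℝ) ^ 2 := by exact_mod_cast hn'
  have h1R : (M : ℝ) ≤ n + m := by exact_mod_cast h1
  have h2R : (n : ℝ) ≤ M + m := by exact_mod_cast h2
  set e := eta lam t with he
  set a := lam * e with ha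
  have he0 : 0 < e := by
    by_contra hc
    push Not at hc
    nlinarith
  have hae : a ≤ e := by rw [ha]; nlinarith
  have hdiff : (n : ℝ) * (e - a) ≤ 4 * m := by
    have e1 : (n : ℝ) * (e - a) = (n * (1 - lam)) * e := by rw [ha]; ring
    have e2 : (n : ℝ) * (1 - lam) ≤ 4 := by nlinarith
    have e3 : 0 ≤ (n : ℝ) * (1 - lam) := mul_nonneg (by positivity) (by linarith)
    rw [e1]; nlinarith
  have hdiff0 : 0 ≤ (n : ℝ) * (e - a) := mul_nonneg (by positivity) (by linarith)
  set c := Real.exp (-(224 / d)) / 10 with hc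
  have hcpos : 0 < c := by positivity
  have hMe : 0 ≤ (M : ℝ) * (1 - e) := mul_nonneg (by positivity) (by linarith)
  set j0 := ⌈(M : ℝ) * (1 - e)⌉₊ with hj0
  have hj1 : (M : ℝ) * (1 - e) ≤ j0 := Nat.le_ceil _
  have hj2 : (j0 : ℝ) < M * (1 - e) + 1 := Nat.ceil_lt_add_one hMe
  have hloc : ∀ j ∈ Finset.Ico j0 (j0 + m),
      c / m ≤ binp M (1 - e) j ∧ c / m ≤ binp n (1 - a) j := by
    intro j hj
    rw [Finset.mem_Ico] at hj
    have a1 : (j0 : ℝ) ≤ j := by exact_mod_cast hj.1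
    have a2 : (j : ℝ) + 1 ≤ j0 + m := by exact_mod_cast hj.2
    have hMn : |((M : ℝ) - n) * (1 - e)| ≤ m := by
      rw [abs_mul, abs_of_nonneg (by linarith : 0 ≤ 1 - e)]
      have : |(M : ℝ) - n| ≤ m := abs_le.mpr ⟨by linarith, by linarith⟩
      have := abs_nonneg ((M : ℝ) - n)
      nlinarith
    have hMn' := abs_le.mp hMn
    have e2 : (n : ℝ) * (1 - a) = M * (1 - e) - (M - n) * (1 - e) + n * (e - a) := by ring
    constructor
    · exact binp_local hd (by linarith) (by linarith) hmR hmd hMR hMR'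
        (abs_le.mpr ⟨by linarith, by linarith⟩)
    · exact binp_local hd (by linarith) (by linarith) hmR hmd hnR hnR'
        (abs_le.mpr ⟨by linarith [hMn'.1, hMn'.2], by linarith [hMn'.1, hMn'.2]⟩)
  have hcm : 0 < c / m := by positivity
  rw [pLeaf_eq, ← he, ← ha]
  have hsub : Finset.Ico j0 (j0 + m) ⊆ Finset.range (M + 1) := by
    intro j hj
    rw [Finset.mem_range]
    by_contra hcon
    have := (hloc j hj).1
    rw [binp, Nat.choose_eq_zero_of_lt (by omega)] at this
    simp at this
    linarith
  have hnn : ∀ j, 0 ≤ (1 - a) * (binp M (1 - e) j * binp n (1 - a) j) := fun j =>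
    mul_nonneg (by linarith) (mul_nonneg (binp_nonneg (by linarith) (by linarith) j)
      (binp_nonneg (by linarith) (by linarith) j))
  refine le_trans ?_ (Finset.sum_le_sum_of_subset_of_nonneg hsub fun j _ _ => hnn j)
  have hle : ∀ j ∈ Finset.Ico j0 (j0 + m), d * (c / m * (c / m)) ≤
      (1 - a) * (binp M (1 - e) j * binp n (1 - a) j) := by
    intro j hj
    obtain ⟨b1, b2⟩ := hloc j hj
    exact mul_le_mul (by linarith) (mul_le_mul b1 b2 hcm.le (hcm.le.trans b1)) (by positivity)
      (by linarith)
  refine le_trans (le_of_eq ?_) (Finset.card_nsmul_le_sum _ _ _ hle)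
  rw [Nat.card_Ico, nsmul_eq_mul, Nat.add_sub_cancel_left]
  field_simp

theorem Ldist_lower {lam t d : ℝ} {m n1 n2 : ℕ} (hl0 : 1 / 2 ≤ lam) (hl : lam < 1) (hd : 0 < d)
    (hd1 : d ≤ lam * eta lam t) (hd2 : eta lam t ≤ 1 - d) (hm : 1 ≤ m) (hmd : 24 ≤ d * m)
    (hlm : (1 - lam) * (m : ℝ) ^ 2 ≤ 1) (hlm' : 1 ≤ (1 - lam) * (4 * (m : ℝ) ^ 2))
    (h1 : m ^ 2 ≤ n1) (h1' : n1 ≤ 2 * m ^ 2) (h2 : n1 ≤ n2) (h2' : n2 ≤ n1 + m) :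
    Real.exp (-8) / 4 * (d * (Real.exp (-(224 / d)) / 10) ^ 2) ^ 2 / (m : ℝ) ^ 3
      ≤ Ldist lam t (n1, n2) := by
  have hl0' : 0 < lam := by linarith
  have he0 : 0 < eta lam t := by
    by_contra hc
    push Not at hc
    nlinarith
  have he1 : eta lam t < 1 := by linarith
  have hmR : (1 : ℝ) ≤ m := by exact_mod_cast hm
  have hmm : m ≤ m ^ 2 := by nlinarith
  set C := d * (Real.exp (-(224 / d)) / 10) ^ 2 with hC
  have hCpos : 0 < C := by positivity
  have hterm : ∀ M ∈ Finset.Ico n1 (n1 + m),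
      Real.exp (-8) * (1 / (4 * (m : ℝ) ^ 2)) * (C / m * (C / m)) ≤
        (1 - lam) * lam ^ M * (pLeaf lam t M n1 * pLeaf lam t M n2) := by
    intro M hM
    rw [Finset.mem_Ico] at hM
    have hMle : (M : ℝ) ≤ 4 * (m : ℝ) ^ 2 := by
      have : M ≤ 4 * m ^ 2 := by omega
      exact_mod_cast this
    have b1 : C / m ≤ pLeaf lam t M n1 :=
      pLeaf_lower hl0' hl hd hd1 hd2 hm hmd hlm (by omega) (by omega) (by omega) (by omega)
        (by omega) (by omega)
    have b2 : C / m ≤ pLeaf lam t M n2 :=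
      pLeaf_lower hl0' hl hd hd1 hd2 hm hmd hlm (by omega) (by omega) (by omega) (by omega)
        (by omega) (by omega)
    have b3 : Real.exp (-8) ≤ lam ^ M := by
      have q1 : Real.exp (-(2 * (1 - lam))) ≤ lam := by
        rw [Real.exp_neg, inv_le_iff_one_le_mul₀ (Real.exp_pos _)]
        have := Real.add_one_le_exp (2 * (1 - lam))
        nlinarith
      refine le_trans ?_ (pow_le_pow_left₀ (Real.exp_pos _).le q1 M)
      rw [← Real.exp_nat_mul, Real.exp_le_exp]
      nlinarith
    have b4 : 1 / (4 * (m : ℝ) ^ 2) ≤ 1 - lam := by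
      rw [div_le_iff₀ (by positivity)]; linarith
    have hcm : 0 < C / m := by positivity
    have b5 : C / m * (C / m) ≤ pLeaf lam t M n1 * pLeaf lam t M n2 :=
      mul_le_mul b1 b2 hcm.le (hcm.le.trans b1)
    have b6 : Real.exp (-8) * (1 / (4 * (m : ℝ) ^ 2)) ≤ (1 - lam) * lam ^ M := by
      rw [mul_comm]
      exact mul_le_mul b4 b3 (Real.exp_pos _).le (by linarith)
    exact mul_le_mul b6 b5 (by positivity) (mul_nonneg (by linarith) (by positivity))
  have hs := Lterm_summable hl0' hl he0 he1 (n1, n2)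
  have h3 := Summable.sum_le_tsum (Finset.Ico n1 (n1 + m))
    (fun M _ => Lterm_nonneg hl0' hl he0 he1 (n1, n2) M) hs
  refine le_trans ?_ h3
  refine le_trans (le_of_eq ?_) (Finset.card_nsmul_le_sum _ _ _ hterm)
  rw [Nat.card_Ico, nsmul_eq_mul, Nat.add_sub_cancel_left]
  field_simp

theorem tv_le_of_overlap (P Q : ℕ × ℕ → ℝ) (hP : ∀ y, 0 ≤ P y) (hQ : ∀ y, 0 ≤ Q y)
    (hP1 : ∀ s : Finset (ℕ × ℕ), ∑ y ∈ s, P y ≤ 1) (hQ1 : ∀ s : Finset (ℕ × ℕ), ∑ y ∈ s, Q y ≤ 1)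
    (A : Finset (ℕ × ℕ)) (ep : ℝ) (hA : ep ≤ ∑ y ∈ A, min (P y) (Q y)) :
    (1 / 2) * ∑' y, |P y - Q y| ≤ 1 - ep := by
  have : ∑' y, |P y - Q y| ≤ 2 - 2 * ep := by
    refine Real.tsum_le_of_sum_le (fun y => abs_nonneg _) fun u => ?_
    have h1 : ∑ y ∈ u, |P y - Q y| ≤ ∑ y ∈ u ∪ A, |P y - Q y| :=
      Finset.sum_le_sum_of_subset_of_nonneg Finset.subset_union_left fun _ _ _ => abs_nonneg _
    have h2 : ∑ y ∈ A, min (P y) (Q y) ≤ ∑ y ∈ u ∪ A, min (P y) (Q y) :=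
      Finset.sum_le_sum_of_subset_of_nonneg Finset.subset_union_right
        fun y _ _ => le_min (hP y) (hQ y)
    have h3 : ∑ y ∈ u ∪ A, |P y - Q y| = ∑ y ∈ u ∪ A, P y + ∑ y ∈ u ∪ A, Q y
        - 2 * ∑ y ∈ u ∪ A, min (P y) (Q y) := by
      rw [Finset.mul_sum, ← Finset.sum_add_distrib, ← Finset.sum_sub_distrib]
      refine Finset.sum_congr rfl fun y _ => ?_
      rcases le_total (P y) (Q y) with h | h
      · rw [min_eq_left h, abs_of_nonpos (by linarith)]; ring
      · rw [min_eq_right h, abs_of_nonneg (by linarith)]; ring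
    have := hP1 (u ∪ A)
    have := hQ1 (u ∪ A)
    linarith
  linarith

theorem eta_bounds {lam h d : ℝ} (hh : 0 < h) (hl0 : 1 / 2 ≤ lam) (hl : lam < 1) (hd : 0 < d)
    (hd1 : d * (h + 1) ≤ Real.exp (-h)) (hd2 : 2 * d * (1 + h) ≤ h) :
    d ≤ lam * eta lam h ∧ eta lam h ≤ 1 - d := by
  unfold eta
  set e := Real.exp (-(1 - lam) * h) with he
  have he0 : 0 < e := Real.exp_pos _
  have hx : 0 < (1 - lam) * h := mul_pos (by linarith) hh
  have he1 : 1 - e ≤ (1 - lam) * h := by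
    have := Real.add_one_le_exp (-(1 - lam) * h)
    rw [← he] at this; linarith
  have he2 : (1 - lam) * h * e ≤ 1 - e := by
    have h1 := Real.add_one_le_exp ((1 - lam) * h)
    have h2 : Real.exp ((1 - lam) * h) * e = 1 := by
      rw [he, ← Real.exp_add, ← Real.exp_zero]; congr 1; ring
    nlinarith
  have he3 : Real.exp (-h) ≤ e := by
    rw [he, Real.exp_le_exp]; nlinarith
  have hel : 0 < 1 - e := lt_of_lt_of_le (by positivity) he2
  have hden : 0 < 1 - lam * e := by nlinarith
  have hl1 : 0 < 1 - lam := by linarith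
  constructor
  · have : 2 * d ≤ (1 - e) / (1 - lam * e) := by
      rw [le_div_iff₀ hden]
      have e1 : 1 - lam * e = (1 - e) + (1 - lam) * e := by ring
      have hd3 : 2 * d ≤ 1 := by nlinarith
      have q : (1 - 2 * d) * ((1 - lam) * h * e) ≤ (1 - 2 * d) * (1 - e) :=
        mul_le_mul_of_nonneg_left he2 (by linarith)
      have q2 : 2 * d * ((1 - lam) * e) ≤ (1 - 2 * d) * h * ((1 - lam) * e) :=
        mul_le_mul_of_nonneg_right (by linarith) (by positivity)
      rw [e1]; linarith
    nlinarith
  · rw [div_le_iff₀ hden]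
    have e1 : 1 - lam * e = (1 - e) + (1 - lam) * e := by ring
    have q1 : d * (1 - e) ≤ d * ((1 - lam) * h) := mul_le_mul_of_nonneg_left he1 hd.le
    have q2 : (1 - lam) * (d * (h + 1)) ≤ (1 - lam) * e :=
      mul_le_mul_of_nonneg_left (by linarith) hl1.le
    have q3 : d * ((1 - lam) * e) ≤ d * (1 - lam) :=
      mul_le_mul_of_nonneg_left (by nlinarith) hd.le
    rw [e1]; linarith

theorem tv_bound {h1 h2 d lam : ℝ} {m : ℕ} (hl0 : 1 / 2 ≤ lam) (hl : lam < 1) (hd : 0 < d)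
    (hm : 1 ≤ m) (hmd : 24 ≤ d * m)
    (hlm : (1 - lam) * (m : ℝ) ^ 2 ≤ 1) (hlm' : 1 ≤ (1 - lam) * (4 * (m : ℝ) ^ 2))
    (a1 : d ≤ lam * eta lam h1) (a2 : eta lam h1 ≤ 1 - d)
    (b1 : d ≤ lam * eta lam h2) (b2 : eta lam h2 ≤ 1 - d) :
    (1 / 2) * ∑' y : ℕ × ℕ, |Ldist lam h1 y - Ldist lam h2 y| ≤
      1 - Real.exp (-8) / 4 * (d * (Real.exp (-(224 / d)) / 10) ^ 2) ^ 2 := by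
  have hl0' : 0 < lam := by linarith
  have hpos : ∀ h, d ≤ lam * eta lam h → 0 < eta lam h := by
    intro h hh
    by_contra hc
    push Not at hc
    nlinarith
  have hmR : (1 : ℝ) ≤ m := by exact_mod_cast hm
  set ep := Real.exp (-8) / 4 * (d * (Real.exp (-(224 / d)) / 10) ^ 2) ^ 2 with hep
  have hinj : Function.Injective fun z : ℕ × ℕ => (m ^ 2 + z.1, m ^ 2 + z.1 + z.2) := by
    rintro ⟨a, b⟩ ⟨a', b'⟩ h
    simp only [Prod.mk.injEq] at h ⊢
    omega
  refine tv_le_of_overlap _ _ (Ldist_nonneg hl0' hl (hpos _ a1) (by linarith))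
    (Ldist_nonneg hl0' hl (hpos _ b1) (by linarith))
    (Ldist_sum hl0' hl (hpos _ a1) (by linarith)) (Ldist_sum hl0' hl (hpos _ b1) (by linarith))
    ((Finset.range (m ^ 2) ×ˢ Finset.range m).image
      fun z : ℕ × ℕ => (m ^ 2 + z.1, m ^ 2 + z.1 + z.2)) ep ?_
  have hle : ∀ y ∈ (Finset.range (m ^ 2) ×ˢ Finset.range m).image
      (fun z : ℕ × ℕ => (m ^ 2 + z.1, m ^ 2 + z.1 + z.2)),
      ep / (m : ℝ) ^ 3 ≤ min (Ldist lam h1 y) (Ldist lam h2 y) := by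
    intro y hy
    obtain ⟨z, hz, rfl⟩ := Finset.mem_image.mp hy
    rw [Finset.mem_product, Finset.mem_range, Finset.mem_range] at hz
    obtain ⟨hz1, hz2⟩ := hz
    exact le_min
      (Ldist_lower hl0 hl hd a1 a2 hm hmd hlm hlm' (by omega) (by omega) (by omega) (by omega))
      (Ldist_lower hl0 hl hd b1 b2 hm hmd hlm hlm' (by omega) (by omega) (by omega) (by omega))
  refine le_trans (le_of_eq ?_) (Finset.card_nsmul_le_sum _ _ _ hle)
  rw [Finset.card_image_of_injective _ hinj, Finset.card_product, Finset.card_range,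
    Finset.card_range, nsmul_eq_mul]
  push_cast
  field_simp

/-- **Impossibility of distance estimation from sequence lengths.**
For heights `h1 > h2 > 0`, the total variation distance between the joint leaf-length
distributions at heights `h1` and `h2` has `limsup < 1` as `λ ↗ 1`. -/
theorem tv_limsup_lt_one (h1 h2 : ℝ) (hh : h1 > h2) (hh2 : h2 > 0) :
    Filter.limsup
      (fun lam : ℝ =>
        (1 / 2) * ∑' y : ℕ × ℕ, |Ldist lam h1 y - Ldist lam h2 y|)
      (nhdsWithin 1 (Set.Iio 1)) < 1 := by
  have hh1 : 0 < h1 := hh2.trans hh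
  obtain ⟨d, hd, c1, c2, c3, c4⟩ : ∃ d : ℝ, 0 < d ∧ d * (h1 + 1) ≤ Real.exp (-h1) ∧
      2 * d * (1 + h1) ≤ h1 ∧ d * (h2 + 1) ≤ Real.exp (-h2) ∧ 2 * d * (1 + h2) ≤ h2 := by
    have hh2' : 0 < h2 := hh2
    refine ⟨min (min (Real.exp (-h1) / (h1 + 1)) (h1 / (2 * (1 + h1))))
      (min (Real.exp (-h2) / (h2 + 1)) (h2 / (2 * (1 + h2)))), by positivity, ?_, ?_, ?_, ?_⟩
    · rw [← le_div_iff₀ (by positivity)]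
      exact (min_le_left _ _).trans (min_le_left _ _)
    · rw [mul_comm 2, mul_assoc, ← le_div_iff₀ (by positivity)]
      exact (min_le_left _ _).trans (min_le_right _ _)
    · rw [← le_div_iff₀ (by positivity)]
      exact (min_le_right _ _).trans (min_le_left _ _)
    · rw [mul_comm 2, mul_assoc, ← le_div_iff₀ (by positivity)]
      exact (min_le_right _ _).trans (min_le_right _ _)
  have hep : 0 < Real.exp (-8) / 4 * (d * (Real.exp (-(224 / d)) / 10) ^ 2) ^ 2 := by positivity
  refine lt_of_le_of_lt (Filter.limsup_le_of_le ?_ ?_ :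
    _ ≤ 1 - Real.exp (-8) / 4 * (d * (Real.exp (-(224 / d)) / 10) ^ 2) ^ 2) (by linarith)
  · refine Filter.IsCoboundedUnder.of_frequently_ge (a := 0) (Filter.Frequently.of_forall ?_)
    intro lam
    have : 0 ≤ ∑' y : ℕ × ℕ, |Ldist lam h1 y - Ldist lam h2 y| :=
      tsum_nonneg fun y => abs_nonneg _
    positivity
  · have hK : 0 < 24 / d + 1 := by positivity
    have hlt : max (1 / 2) (1 - (1 / (24 / d + 1)) ^ 2) < (1 : ℝ) := by
      refine max_lt (by norm_num) ?_
      have : 0 < (1 / (24 / d + 1)) ^ 2 := by positivity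
      linarith
    filter_upwards [Ioo_mem_nhdsLT hlt] with lam hlam
    obtain ⟨hlamL, hl⟩ := hlam
    have hl0 : 1 / 2 ≤ lam := ((le_max_left _ _).trans_lt hlamL).le
    have hl2 : 1 - lam ≤ (1 / (24 / d + 1)) ^ 2 := by
      have := (le_max_right (1 / 2 : ℝ) _).trans_lt hlamL
      linarith
    set r := Real.sqrt (1 - lam) with hr
    have hr0 : 0 < r := Real.sqrt_pos.mpr (by linarith)
    have hr2 : r ^ 2 = 1 - lam := Real.sq_sqrt (by linarith)
    have hrle : r ≤ 1 / (24 / d + 1) := Real.sqrt_le_iff.mpr ⟨by positivity, hl2⟩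
    have hrinv : 24 / d + 1 ≤ 1 / r := by
      rw [le_div_iff₀ hr0]
      rw [le_div_iff₀ hK] at hrle
      linarith
    set m := ⌊1 / r⌋₊ with hmdef
    have hm1 : (m : ℝ) ≤ 1 / r := Nat.floor_le (by positivity)
    have hm2 : 1 / r < (m : ℝ) + 1 := Nat.lt_floor_add_one _
    have hmd : 24 ≤ d * m := by
      have : 24 / d ≤ m := by linarith
      rw [div_le_iff₀ hd] at this
      linarith
    have hm : 1 ≤ m := by
      rcases Nat.eq_zero_or_pos m with h | h
      · rw [h] at hmd; norm_num at hmd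
      · exact h
    have hmR : (1 : ℝ) ≤ m := by exact_mod_cast hm
    rw [le_div_iff₀ hr0] at hm1
    rw [div_lt_iff₀ hr0] at hm2
    have hmr : 0 ≤ (m : ℝ) * r := by positivity
    have hlm : (1 - lam) * (m : ℝ) ^ 2 ≤ 1 := by
      rw [← hr2]
      nlinarith
    have hlm' : 1 ≤ (1 - lam) * (4 * (m : ℝ) ^ 2) := by
      rw [← hr2]
      have : 1 ≤ 2 * ((m : ℝ) * r) := by nlinarith
      nlinarith
    obtain ⟨a1, a2⟩ := eta_bounds hh1 hl0 hl hd c1 c2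
    obtain ⟨b1, b2⟩ := eta_bounds hh2 hl0 hl hd c3 c4
    exact tv_bound hl0 hl hd hm hmd hlm hlm' a1 a2 b1 b2
end

section
/- For every λ ∈ (0,1) and t > 0, the variance of the distribution p_{λ,t} equals ((1+λ)/(1−λ)) · e^{−(1−λ)t} · (1 − e^{−(1−λ)t}); that is, Σ_{n≥0} (n − e^{−(1−λ)t})² · p_{λ,t}(n) = ((1+λ)/(1−λ)) e^{−(1−λ)t}(1 − e^{−(1−λ)t}). -/
open Set Filter MeasureTheory

/-- The variance of `p_{λ,t}` equals `((1+λ)/(1-λ)) e^{-(1-λ)t}(1 - e^{-(1-λ)t})`. -/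
theorem pTKF_variance (lam t : ℝ) (hlam : lam ∈ Set.Ioo (0 : ℝ) 1) (ht : 0 < t) :
    ∑' n : ℕ, ((n : ℝ) - Real.exp (-(1 - lam) * t)) ^ 2 * pTKF lam t n =
      ((1 + lam) / (1 - lam)) * Real.exp (-(1 - lam) * t) *
        (1 - Real.exp (-(1 - lam) * t)) := by
  obtain ⟨h0, h1⟩ := hlam
  have hb1 : Real.exp (-(1 - lam) * t) < 1 := by
    rw [Real.exp_lt_one_iff]
    nlinarith
  have hb0 : 0 < Real.exp (-(1 - lam) * t) := Real.exp_pos _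
  have heta : eta lam t =
    (1 - Real.exp (-(1 - lam) * t)) / (1 - lam * Real.exp (-(1 - lam) * t)) := rfl
  generalize Real.exp (-(1 - lam) * t) = b at *
  have hD : 0 < 1 - lam * b := by nlinarith
  have hl : 0 < 1 - lam := by linarith
  have hD' := hD.ne'
  have hl' := hl.ne'
  have hD2 : 1 - b * lam ≠ 0 := by rwa [mul_comm]
  have hx1 : 1 - lam * eta lam t = (1 - lam) / (1 - lam * b) := by
    rw [heta]; field_simp; ring
  have he1 : 1 - eta lam t = b * (1 - lam) / (1 - lam * b) := by
    rw [heta]; field_simp; ring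
  have he0 : 0 < eta lam t := by
    rw [heta]; exact div_pos (by linarith) hD
  have hx0 : 0 < lam * eta lam t := mul_pos h0 he0
  have hxp : 0 < 1 - lam * eta lam t := by rw [hx1]; positivity
  have hn : ‖lam * eta lam t‖ < 1 := by
    rw [Real.norm_eq_abs, abs_of_pos hx0]; linarith
  have s0 := hasSum_choose_mul_geometric_of_norm_lt_one 0 hn
  have s1 := hasSum_choose_mul_geometric_of_norm_lt_one 1 hn
  have s2 := hasSum_choose_mul_geometric_of_norm_lt_one 2 hn
  have key := ((((s2.mul_left 2).sub (s1.mul_left (1 + 2 * b))).add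
    (s0.mul_left (b ^ 2))).mul_left ((1 - eta lam t) * (1 - lam * eta lam t)))
  have hs : HasSum (fun n : ℕ => (((n + 1 : ℕ) : ℝ) - b) ^ 2 * pTKF lam t (n + 1))
      ((1 - eta lam t) * (1 - lam * eta lam t) *
      (2 * (1 / (1 - lam * eta lam t) ^ (2 + 1)) - (1 + 2 * b) * (1 / (1 - lam * eta lam t) ^ (1 + 1)) +
        b ^ 2 * (1 / (1 - lam * eta lam t) ^ (0 + 1)))) := by
    refine Eq.mp (congrArg (fun f => HasSum f _) (funext fun n => ?_)) key
    have c2 : (((n + 2).choose 2 : ℕ) : ℝ) = ((n : ℝ) + 2) * (n + 1) / 2 := by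
      rw [Nat.cast_choose_two]; push_cast; ring
    simp only [pTKF, c2, Nat.choose_one_right, Nat.choose_zero_right]
    push_cast
    ring
  have hs2 := (hasSum_nat_add_iff (f := fun n : ℕ => ((n : ℝ) - b) ^ 2 * pTKF lam t n) 1).1 hs
  rw [hs2.tsum_eq, hx1, he1]
  simp only [Finset.sum_range_one, pTKF, heta]
  push_cast
  field_simp
  ring
end

section
/- Fix t > 0 and λ* ∈ (0,1). Let σ(λ,t) denote the standard deviation of p_{λ,t} and ρ(λ,t) = Σ_{n≥0} |n − β(λ,t)|³ p_{λ,t}(n) its absolute third central moment, where β(λ,t) = e^{−(1−λ)t}. Then 0 < inf_{λ ∈ [λ*,1)} σ(λ,t) ≤ sup_{λ ∈ [λ*,1)} σ(λ,t) < ∞ and sup_{λ ∈ [λ*,1)} ρ(λ,t) < ∞. -/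
open Set Filter MeasureTheory

theorem eta_bounds_aux (t lam : ℝ) (ht : 0 < t) (h0 : 0 < lam) (h1 : lam < 1) :
    t / (1 + t) ≤ eta lam t ∧ eta lam t ≤ t / (t + Real.exp (-t)) ∧
    Real.exp (-t) ≤ betaTKF lam t ∧ betaTKF lam t ≤ 1 := by
  have hs : 0 < 1 - lam := by linarith
  have hst : 0 < (1 - lam) * t := by positivity
  have e1 : Real.exp (-t) ≤ Real.exp (-(1 - lam) * t) := by
    apply Real.exp_le_exp.mpr; nlinarith
  have e2 : Real.exp (-(1 - lam) * t) ≤ 1 := by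
    apply Real.exp_le_one_iff.mpr; nlinarith
  have e3 : 1 - Real.exp (-(1 - lam) * t) ≤ (1 - lam) * t := by
    have := Real.add_one_le_exp (-(1 - lam) * t)
    linarith
  have e4 : (1 - lam) * t * Real.exp (-(1 - lam) * t) ≤ 1 - Real.exp (-(1 - lam) * t) := by
    have h := Real.add_one_le_exp ((1 - lam) * t)
    have hp := Real.exp_pos (-(1 - lam) * t)
    have hm : Real.exp ((1 - lam) * t) * Real.exp (-(1 - lam) * t) = 1 := by
      rw [← Real.exp_add, ← Real.exp_zero]; congr 1; ring
    nlinarith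
  have hpt := Real.exp_pos (-t)
  unfold eta betaTKF
  generalize Real.exp (-(1 - lam) * t) = e at *
  generalize Real.exp (-t) = d at *
  have hden : 0 < 1 - lam * e := by nlinarith
  refine ⟨?_, ?_, e1, e2⟩
  · rw [div_le_div_iff₀ (by positivity) hden]
    nlinarith
  · rw [div_le_div_iff₀ hden (by positivity)]
    have k1 : (1 - e) * d ≤ (1 - lam) * t * d := mul_le_mul_of_nonneg_right e3 hpt.le
    have k2 : (1 - lam) * t * d ≤ (1 - lam) * t * e := mul_le_mul_of_nonneg_left e1 hst.le
    nlinarith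

theorem pTKF_bounds_aux (lam t E : ℝ) (h0 : 0 < lam) (h1 : lam < 1) (he : 0 ≤ eta lam t)
    (hE : eta lam t ≤ E) (hE0 : 0 < E) (hE1 : E < 1) (n : ℕ) :
    0 ≤ pTKF lam t n ∧ pTKF lam t n ≤ E ^ n / E := by
  have hle : lam * eta lam t ≤ E := by nlinarith
  have hl0 : 0 ≤ lam * eta lam t := by positivity
  cases n with
  | zero =>
    simp only [pTKF, pow_zero]
    refine ⟨he, ?_⟩
    rw [le_div_iff₀ hE0]; nlinarith
  | succ n =>
    simp only [pTKF]
    have a1 : 0 ≤ 1 - eta lam t := by linarith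
    have a2 : 0 ≤ 1 - lam * eta lam t := by linarith
    refine ⟨by positivity, ?_⟩
    rw [pow_succ, mul_div_assoc, div_self hE0.ne', mul_one]
    have b1 : (1 - eta lam t) * (1 - lam * eta lam t) ≤ 1 :=
      mul_le_one₀ (by linarith) a2 (by linarith)
    have b2 : (lam * eta lam t) ^ n ≤ E ^ n := pow_le_pow_left₀ hl0 hle n
    have b3 : 0 ≤ (lam * eta lam t) ^ n := by positivity
    nlinarith

/-- Uniformly in `λ ∈ [λ*,1)`: the standard deviation of `p_{λ,t}` is bounded away from `0`
and bounded above, and the absolute third central moment is bounded above. -/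
theorem sdev_rho_uniform_bounds (t lamstar : ℝ) (ht : 0 < t)
    (hl : lamstar ∈ Set.Ioo (0 : ℝ) 1) :
    ∃ a b c : ℝ, 0 < a ∧
      (∀ lam ∈ Set.Ico lamstar (1 : ℝ), a ≤ sdev lam t ∧ sdev lam t ≤ b) ∧
      (∀ lam ∈ Set.Ico lamstar (1 : ℝ),
        Summable (fun n : ℕ => |(n : ℝ) - betaTKF lam t| ^ 3 * pTKF lam t n) ∧
        ∑' n : ℕ, |(n : ℝ) - betaTKF lam t| ^ 3 * pTKF lam t n ≤ c) := by
  have hpt := Real.exp_pos (-t)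
  obtain ⟨E, hEdef⟩ : ∃ E, E = t / (t + Real.exp (-t)) := ⟨_, rfl⟩
  have hE0 : 0 < E := by rw [hEdef]; positivity
  have hE1 : E < 1 := by rw [hEdef, div_lt_one (by positivity)]; linarith
  have hS : Summable (fun n : ℕ => ((n : ℝ) + 1) ^ 3 * (E ^ n / E)) := by
    have h := summable_pow_mul_geometric_of_norm_lt_one (R := ℝ) 3 (r := E)
      (by rw [Real.norm_eq_abs, abs_of_pos hE0]; exact hE1)
    have h2 := ((summable_nat_add_iff 1).mpr h).mul_right (1 / E ^ 2)
    refine h2.congr fun n => ?_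
    push_cast
    field_simp
    ring
  have key : ∀ lam ∈ Set.Ico lamstar (1 : ℝ), ∀ n : ℕ,
      0 ≤ pTKF lam t n ∧ |(n : ℝ) - betaTKF lam t| ^ 3 * pTKF lam t n
          ≤ ((n : ℝ) + 1) ^ 3 * (E ^ n / E) ∧
        ((n : ℝ) - betaTKF lam t) ^ 2 * pTKF lam t n ≤ ((n : ℝ) + 1) ^ 3 * (E ^ n / E) := by
    intro lam hlam n
    have h0 : 0 < lam := lt_of_lt_of_le hl.1 hlam.1
    obtain ⟨b1, b2, b3, b4⟩ := eta_bounds_aux t lam ht h0 hlam.2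
    have he : 0 ≤ eta lam t := le_trans (by positivity) b1
    obtain ⟨p0, p1⟩ := pTKF_bounds_aux lam t E h0 hlam.2 he (hEdef ▸ b2) hE0 hE1 n
    have hn : (0 : ℝ) ≤ n := Nat.cast_nonneg n
    have habs : |(n : ℝ) - betaTKF lam t| ≤ n + 1 := by
      rw [abs_le]; constructor <;> linarith
    refine ⟨p0, ?_, ?_⟩
    · exact mul_le_mul (pow_le_pow_left₀ (abs_nonneg _) habs 3) p1 p0 (by positivity)
    · refine mul_le_mul ?_ p1 p0 (by positivity)
      rw [← sq_abs]
      exact (pow_le_pow_left₀ (abs_nonneg _) habs 2).trans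
        (pow_le_pow_right₀ (by linarith) (by norm_num))
  refine ⟨Real.sqrt (Real.exp (-t) ^ 2 * (t / (1 + t))),
    Real.sqrt (∑' n : ℕ, ((n : ℝ) + 1) ^ 3 * (E ^ n / E)),
    ∑' n : ℕ, ((n : ℝ) + 1) ^ 3 * (E ^ n / E), Real.sqrt_pos.mpr (by positivity), ?_, ?_⟩
  · intro lam hlam
    have h0 : 0 < lam := lt_of_lt_of_le hl.1 hlam.1
    have hnn : ∀ n : ℕ, 0 ≤ ((n : ℝ) - betaTKF lam t) ^ 2 * pTKF lam t n := fun n =>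
      mul_nonneg (sq_nonneg _) (key lam hlam n).1
    have hs : Summable (fun n : ℕ => ((n : ℝ) - betaTKF lam t) ^ 2 * pTKF lam t n) :=
      Summable.of_nonneg_of_le hnn (fun n => (key lam hlam n).2.2) hS
    refine ⟨Real.sqrt_le_sqrt ?_, Real.sqrt_le_sqrt
      (hs.tsum_le_tsum (fun n => (key lam hlam n).2.2) hS)⟩
    obtain ⟨b1, b2, b3, b4⟩ := eta_bounds_aux t lam ht h0 hlam.2
    refine le_trans ?_ (hs.le_tsum 0 fun n _ => hnn n)
    simp only [pTKF, Nat.cast_zero, zero_sub, neg_sq]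
    exact mul_le_mul (pow_le_pow_left₀ hpt.le b3 2) b1 (by positivity) (by positivity)
  · intro lam hlam
    have hs : Summable (fun n : ℕ => |(n : ℝ) - betaTKF lam t| ^ 3 * pTKF lam t n) :=
      Summable.of_nonneg_of_le
        (fun n => mul_nonneg (by positivity) (key lam hlam n).1)
        (fun n => (key lam hlam n).2.1) hS
    exact ⟨hs, hs.tsum_le_tsum (fun n => (key lam hlam n).2.1) hS⟩
end

section
/- Fix t > 0, λ* ∈ (0,1), and a positive integer k. Then the k-th moment of p_{λ,t} is bounded uniformly in λ ∈ [λ*,1): sup_{λ ∈ [λ*,1)} Σ_{n≥0} n^k · p_{λ,t}(n) < ∞. -/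
open Set Filter MeasureTheory

theorem eta_bounds_s5 (t lam : ℝ) (ht : 0 < t) (h0 : 0 < lam) (h1 : lam < 1) :
    0 ≤ eta lam t ∧ eta lam t ≤ t / (t + Real.exp (-t)) := by
  unfold eta
  have hE1 : Real.exp (-(1 - lam) * t) < 1 := by
    rw [Real.exp_lt_one_iff]
    nlinarith
  have hEt : Real.exp (-t) ≤ Real.exp (-(1 - lam) * t) := by
    apply Real.exp_le_exp.mpr
    nlinarith
  have hlin : -(1 - lam) * t + 1 ≤ Real.exp (-(1 - lam) * t) := Real.add_one_le_exp _
  have hpos : 0 < Real.exp (-t) := Real.exp_pos _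
  generalize Real.exp (-(1 - lam) * t) = E at *
  generalize Real.exp (-t) = F at *
  have hd : 0 < 1 - lam * E := by nlinarith
  refine ⟨div_nonneg (by linarith) hd.le, ?_⟩
  rw [div_le_div_iff₀ hd (by linarith)]
  have h2 : (1 - E) * F ≤ ((1 - lam) * t) * E :=
    mul_le_mul (by linarith) hEt hpos.le (mul_nonneg (by linarith) ht.le)
  nlinarith

/-- The `k`-th moment of `p_{λ,t}` is bounded uniformly in `λ ∈ [λ*,1)`. -/
theorem pTKF_moment_uniform_bound (t lamstar : ℝ) (k : ℕ) (ht : 0 < t)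
    (hl : lamstar ∈ Set.Ioo (0 : ℝ) 1) (hk : 0 < k) :
    ∃ C : ℝ, ∀ lam ∈ Set.Ico lamstar (1 : ℝ),
      Summable (fun n : ℕ => (n : ℝ) ^ k * pTKF lam t n) ∧
      ∑' n : ℕ, (n : ℝ) ^ k * pTKF lam t n ≤ C := by
  obtain ⟨hl0, hl1⟩ := hl
  have hF : 0 < Real.exp (-t) := Real.exp_pos _
  obtain ⟨r, hr⟩ : ∃ r, r = t / (t + Real.exp (-t)) := ⟨_, rfl⟩
  have hr0 : 0 < r := by rw [hr]; positivity
  have hr1 : r < 1 := by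
    rw [hr, div_lt_one (by positivity)]
    linarith
  have hnorm : ‖r‖ < 1 := by rwa [Real.norm_of_nonneg hr0.le]
  have hs0 : Summable (fun n : ℕ => (n : ℝ) ^ k * r ^ n) :=
    summable_pow_mul_geometric_of_norm_lt_one (R := ℝ) k hnorm
  have hs : Summable (fun n : ℕ => (n : ℝ) ^ k * r ^ n / r) := by
    simp only [div_eq_mul_inv]
    exact hs0.mul_right r⁻¹
  obtain ⟨S, hS⟩ := hs
  refine ⟨S, ?_⟩
  intro lam hlam
  obtain ⟨ha, hb⟩ := hlam
  have hlam0 : 0 < lam := lt_of_lt_of_le hl0 ha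
  obtain ⟨he0, he1⟩ := eta_bounds_s5 t lam ht hlam0 hb
  rw [← hr] at he1
  have hle0 : 0 ≤ lam * eta lam t := mul_nonneg hlam0.le he0
  have hle1 : lam * eta lam t ≤ r :=
    (mul_le_of_le_one_left he0 hb.le).trans he1
  have hp : ∀ n : ℕ, 0 ≤ (n : ℝ) ^ k * pTKF lam t n ∧
      (n : ℝ) ^ k * pTKF lam t n ≤ (n : ℝ) ^ k * r ^ n / r := by
    intro n
    rcases n with _ | n
    · rw [Nat.cast_zero, zero_pow hk.ne']
      simp only [zero_mul, zero_div, le_refl, and_self]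
    · have hc0 : 0 ≤ (1 - eta lam t) * (1 - lam * eta lam t) :=
        mul_nonneg (by linarith) (by linarith)
      have hc1 : (1 - eta lam t) * (1 - lam * eta lam t) ≤ 1 :=
        mul_le_one₀ (by linarith) (by linarith) (by linarith)
      have hq0 : 0 ≤ pTKF lam t (n + 1) := by
        rw [pTKF]
        exact mul_nonneg hc0 (pow_nonneg hle0 n)
      have hq1 : pTKF lam t (n + 1) ≤ r ^ (n + 1) / r := by
        have e : r ^ (n + 1) / r = 1 * r ^ n := by
          field_simp
          ring
        rw [e, pTKF]
        exact mul_le_mul hc1 (pow_le_pow_left₀ hle0 hle1 n) (pow_nonneg hle0 n) zero_le_one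
      refine ⟨mul_nonneg (pow_nonneg (Nat.cast_nonneg _) _) hq0, ?_⟩
      rw [mul_div_assoc]
      exact mul_le_mul_of_nonneg_left hq1 (pow_nonneg (Nat.cast_nonneg _) _)
  have hsum := Summable.of_nonneg_of_le (fun n => (hp n).1) (fun n => (hp n).2) hS.summable
  exact ⟨hsum, hasSum_le (fun n => (hp n).2) hsum.hasSum hS⟩
end

section
/- Fix t > 0 and λ* ∈ (0,1). There exists a constant C > 0 such that for every integer M ≥ 1, every λ ∈ [λ*,1), and every x ∈ ℝ, |P(S_M(λ,t) ≤ M·β(λ,t) + x·σ(λ,t)·√M) − Φ(x)| ≤ C/√M, where Φ is the cumulative distribution function of the standard normal distribution, β(λ,t) = e^{−(1−λ)t} is the mean of p_{λ,t}, and σ(λ,t) is its standard deviation. -/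
open Set Filter MeasureTheory

open ProbabilityTheory Topology
open scoped NNReal ENNReal

namespace BE

/-- standard normal density -/
noncomputable def ph (x : ℝ) : ℝ := Real.exp (-x ^ 2 / 2) / Real.sqrt (2 * Real.pi)
noncomputable def ph1 (x : ℝ) : ℝ := -x * ph x
noncomputable def ph2 (x : ℝ) : ℝ := (x ^ 2 - 1) * ph x
noncomputable def ph3 (x : ℝ) : ℝ := (3 * x - x ^ 3) * ph x

lemma hasDerivAt_ph (x : ℝ) : HasDerivAt ph (ph1 x) x := by
  unfold ph ph1 ph
  have h : HasDerivAt (fun x : ℝ => -x ^ 2 / 2) (-x) x := by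
    have := ((hasDerivAt_pow 2 x).neg).div_const 2
    exact this.congr_deriv (by simp; ring)
  exact (h.exp.div_const _).congr_deriv (by ring)

lemma hasDerivAt_ph1 (x : ℝ) : HasDerivAt ph1 (ph2 x) x := by
  have := (hasDerivAt_id x).neg.mul (hasDerivAt_ph x)
  exact this.congr_deriv (by simp [ph1, ph2]; ring)

lemma hasDerivAt_ph2 (x : ℝ) : HasDerivAt ph2 (ph3 x) x := by
  have := ((hasDerivAt_pow 2 x).sub_const 1).mul (hasDerivAt_ph x)
  exact this.congr_deriv (by simp [ph1, ph3]; ring)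

lemma ph_nonneg (x : ℝ) : 0 ≤ ph x := by unfold ph; positivity

lemma ph_le (x : ℝ) : ph x ≤ 1 := by
  unfold ph
  rw [div_le_one (by positivity)]
  have h1 : Real.exp (-x ^ 2 / 2) ≤ 1 := by
    rw [Real.exp_le_one_iff]; nlinarith [sq_nonneg x]
  refine h1.trans ?_
  rw [Real.one_le_sqrt]
  nlinarith [Real.pi_gt_three]

lemma integrable_pow_ph (n : ℕ) : Integrable (fun x => x ^ n * ph x) := by
  have h := integrable_rpow_mul_exp_neg_mul_sq (b := 1 / 2) (by norm_num) (s := n)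
    (by have : (0:ℝ) ≤ n := n.cast_nonneg
        linarith)
  have := h.div_const (Real.sqrt (2 * Real.pi))
  refine this.congr (Eventually.of_forall fun x => ?_)
  simp only [Real.rpow_natCast, ph]
  rw [mul_div_assoc]
  congr 3
  ring

lemma integrable_ph : Integrable ph := by simpa using integrable_pow_ph 0
lemma integrable_ph1 : Integrable ph1 := by
  have := (integrable_pow_ph 1).neg
  refine this.congr (Eventually.of_forall fun x => ?_)
  simp [ph1]
lemma integrable_ph2 : Integrable ph2 := by
  have := (integrable_pow_ph 2).sub (integrable_pow_ph 0)
  refine this.congr (Eventually.of_forall fun x => ?_)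
  simp [ph2]; ring
lemma integrable_ph3 : Integrable ph3 := by
  have := ((integrable_pow_ph 1).const_mul 3).sub (integrable_pow_ph 3)
  refine this.congr (Eventually.of_forall fun x => ?_)
  simp [ph3]; ring

/-- functions with integrable derivative: representation -/
lemma rep_of_integrable {f f' : ℝ → ℝ} (hd : ∀ x, HasDerivAt f (f' x) x) (hf : Integrable f)
    (hf' : Integrable f') (x : ℝ) : f x = ∫ z in Iic x, f' z := by
  have ht := tendsto_zero_of_hasDerivAt_of_integrableOn_Iic (a := x) (fun y _ => hd y)
    hf'.integrableOn hf.integrableOn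
  rw [integral_Iic_of_hasDerivAt_of_tendsto' (fun y _ => hd y) hf'.integrableOn ht, sub_zero]

lemma bound_of_integrable {f f' : ℝ → ℝ} (hd : ∀ x, HasDerivAt f (f' x) x) (hf : Integrable f)
    (hf' : Integrable f') (x : ℝ) : |f x| ≤ ∫ z, |f' z| := by
  rw [rep_of_integrable hd hf hf' x]
  calc |∫ z in Iic x, f' z| ≤ ∫ z in Iic x, |f' z| := abs_integral_le_integral_abs
    _ ≤ _ := setIntegral_le_integral hf'.abs (Eventually.of_forall fun z => abs_nonneg _)

lemma stdNormalCDF_eq (x : ℝ) : stdNormalCDF x = ∫ u in Iic x, ph u := rfl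

lemma hasDerivAt_cdf (x : ℝ) : HasDerivAt stdNormalCDF (ph x) x := by
  have hc : Continuous ph := continuous_iff_continuousAt.2 fun x => (hasDerivAt_ph x).continuousAt
  have h : ∀ y, stdNormalCDF y = stdNormalCDF 0 + ∫ u in (0:ℝ)..y, ph u := by
    intro y
    rw [stdNormalCDF_eq, stdNormalCDF_eq,
      ← intervalIntegral.integral_Iic_sub_Iic integrable_ph.integrableOn integrable_ph.integrableOn]
    ring
  have h2 : HasDerivAt (fun y => stdNormalCDF 0 + ∫ u in (0:ℝ)..y, ph u) (ph x) x :=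
    (hc.integral_hasStrictDerivAt 0 x).hasDerivAt.const_add _
  exact h2.congr_of_eventuallyEq (Eventually.of_forall h)

/-- centered Gaussian with natural-number variance -/
noncomputable def gam (n : ℕ) : Measure ℝ := gaussianReal 0 (n : ℝ≥0)

instance (n : ℕ) : IsProbabilityMeasure (gam n) := by unfold gam; infer_instance

lemma gam_conv (m n : ℕ) : gam m ∗ gam n = gam (m + n) := by
  unfold gam
  rw [gaussianReal_conv_gaussianReal]
  simp

lemma gam_zero : gam 0 = Measure.dirac 0 := by simp [gam]

/-- distribution function of a measure -/
noncomputable def F (P : Measure ℝ) (x : ℝ) : ℝ := P.real (Iic x)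

lemma F_nonneg (P : Measure ℝ) (x : ℝ) : 0 ≤ F P x := measureReal_nonneg
lemma F_le_one (P : Measure ℝ) [IsProbabilityMeasure P] (x : ℝ) : F P x ≤ 1 := measureReal_le_one
lemma F_mono (P : Measure ℝ) [IsProbabilityMeasure P] : Monotone (F P) :=
  fun _ _ h => measureReal_mono (Iic_subset_Iic.2 h)
lemma F_meas (P : Measure ℝ) [IsProbabilityMeasure P] : Measurable (F P) := (F_mono P).measurable

lemma F_gam_one (x : ℝ) : F (gam 1) x = stdNormalCDF x := by
  unfold F gam Measure.real
  rw [gaussianReal_apply_eq_integral _ (by simp), ENNReal.toReal_ofReal]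
  · rw [stdNormalCDF_eq]
    congr 1
    ext u
    simp [gaussianPDFReal, ph]
    ring
  · exact setIntegral_nonneg measurableSet_Iic fun x _ => gaussianPDFReal_nonneg _ _ _

lemma F_gam (n : ℕ) (hn : 1 ≤ n) (x : ℝ) : F (gam n) x = stdNormalCDF (x / Real.sqrt n) := by
  have hs : 0 < Real.sqrt n := Real.sqrt_pos.2 (by exact_mod_cast hn)
  have h : gam n = (gam 1).map (fun y => Real.sqrt n * y) := by
    unfold gam
    rw [gaussianReal_map_const_mul]
    congr 1
    · simp
    · ext; simp
  rw [← F_gam_one]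
  unfold F
  rw [h, map_measureReal_apply (by fun_prop) measurableSet_Iic]
  congr 1
  ext y
  simp [le_div_iff₀ hs, mul_comm]

lemma F_conv (P Q : Measure ℝ) [IsProbabilityMeasure P] [IsProbabilityMeasure Q] (x : ℝ) :
    F (P ∗ Q) x = ∫ u, F P (x - u) ∂Q := by
  have hm : Measurable (indicator (Iic x) (1 : ℝ → ℝ≥0∞)) :=
    measurable_one.indicator measurableSet_Iic
  have : (P ∗ Q) (Iic x) = ∫⁻ u, P (Iic (x - u)) ∂Q := by
    rw [Measure.conv_comm, ← lintegral_indicator_one measurableSet_Iic, Measure.lintegral_conv hm]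
    refine lintegral_congr fun u => ?_
    rw [← lintegral_indicator_one measurableSet_Iic]
    refine lintegral_congr fun y => ?_
    simp only [indicator, mem_Iic, le_sub_iff_add_le', Pi.one_apply]
  unfold F
  rw [Measure.real, this, ← integral_toReal]
  · rfl
  · have : Measurable fun u => P (Iic (x - u)) := by
      have : Antitone fun u => P (Iic (x - u)) := fun a b h =>
        measure_mono (Iic_subset_Iic.2 (by linarith))
      exact this.measurable
    exact this.aemeasurable
  · exact Eventually.of_forall fun u => measure_lt_top _ _

/-- scaled functions -/
lemma scaled_deriv {f f' : ℝ → ℝ} (hd : ∀ x, HasDerivAt f (f' x) x) (s : ℝ) (c : ℝ) (x : ℝ) :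
    HasDerivAt (fun y => f (y / s) / c) (f' (x / s) / (c * s)) x := by
  have := ((hd (x / s)).comp x ((hasDerivAt_id x).div_const s)).div_const c
  exact this.congr_deriv (by rw [mul_one_div, div_div, mul_comm])

lemma taylor {f f1 f2 f3 : ℝ → ℝ} (h1 : ∀ x, HasDerivAt f (f1 x) x)
    (h2 : ∀ x, HasDerivAt f1 (f2 x) x) (h3 : ∀ x, HasDerivAt f2 (f3 x) x) {K : ℝ}
    (hK : ∀ x, |f3 x| ≤ K) (x u : ℝ) :
    |f (x - u) - (f x - u * f1 x + u ^ 2 / 2 * f2 x)| ≤ K * |u| ^ 3 := by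
  have mv : ∀ (g g' : ℝ → ℝ) (B : ℝ), (∀ y, HasDerivAt g (g' y) y) → g 0 = 0 →
      ∀ r, (∀ y, |y| ≤ r → |g' y| ≤ B) → ∀ y, |y| ≤ r → |g y| ≤ B * |y| := by
    intro g g' B hg h0 r hB y hy
    have hc : Convex ℝ (Icc (-r) r) := convex_Icc _ _
    have := hc.norm_image_sub_le_of_norm_hasDerivWithin_le (f := g) (f' := g') (C := B) (x := 0)
      (y := y) (fun z _ => (hg z).hasDerivWithinAt) (fun z hz => hB z (abs_le.2 hz))
      (abs_le.1 (by rw [abs_zero]; exact (abs_nonneg y).trans hy)) (abs_le.1 hy)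
    simpa [h0] using this
  have hK0 : 0 ≤ K := (abs_nonneg _).trans (hK 0)
  have sh : ∀ (g g' : ℝ → ℝ), (∀ y, HasDerivAt g (g' y) y) →
      ∀ y, HasDerivAt (fun s => g (x + s)) (g' (x + y)) y := fun g g' hg y => by
    simpa using (hg (x + y)).comp_const_add x y
  have e2 := mv (fun s => f2 (x + s) - f2 x) (fun s => f3 (x + s)) K
    (fun y => (sh _ _ h3 y).sub_const _) (by simp) |u| (fun y _ => hK _)
  have e1 := mv (fun s => f1 (x + s) - f1 x - s * f2 x) (fun s => f2 (x + s) - f2 x) (K * |u|)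
    (fun y => by
      have := ((sh _ _ h2 y).sub_const (f1 x)).sub ((hasDerivAt_id y).mul_const (f2 x))
      exact this.congr_deriv (by simp)) (by simp) |u| (fun y hy => (e2 y hy).trans (by gcongr))
  have e0 := mv (fun s => f (x + s) - f x - s * f1 x - s ^ 2 / 2 * f2 x)
    (fun s => f1 (x + s) - f1 x - s * f2 x) (K * |u| * |u|)
    (fun y => by
      have := (((sh _ _ h1 y).sub_const (f x)).sub ((hasDerivAt_id y).mul_const (f1 x))).sub
        (((hasDerivAt_pow 2 y).div_const 2).mul_const (f2 x))
      exact this.congr_deriv (by simp)) (by simp) |u| (fun y hy => (e1 y hy).trans (by gcongr)) (-u) (by simp)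
  simp only [abs_neg] at e0
  calc _ = |f (x + -u) - f x - -u * f1 x - (-u) ^ 2 / 2 * f2 x| := by congr 1; ring_nf
    _ ≤ _ := e0
    _ = _ := by ring

/-- moment hypotheses -/
structure Mom (μ : Measure ℝ) (ρ : ℝ) : Prop where
  int3 : Integrable (fun x => |x| ^ 3) μ
  int2 : Integrable (fun x => x ^ 2) μ
  int1 : Integrable (fun x => x) μ
  mean : ∫ x, x ∂μ = 0
  var : ∫ x, x ^ 2 ∂μ = 1
  third : ∫ x, |x| ^ 3 ∂μ ≤ ρ

lemma mom_gam : Mom (gam 1) (∫ x, |x| ^ 3 ∂(gam 1)) where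
  int3 := by
    have := (memLp_id_gaussianReal (μ := 0) (v := 1) 3).integrable_norm_pow (p := 3) (by norm_num)
    simpa [gam] using this
  int2 := by
    have := (memLp_id_gaussianReal (μ := 0) (v := 1) 2).integrable_norm_pow (p := 2) (by norm_num)
    simpa [gam] using this
  int1 := by
    have := (memLp_id_gaussianReal (μ := 0) (v := 1) 1)
    rw [ENNReal.coe_one, memLp_one_iff_integrable] at this
    simp only [gam, Nat.cast_one]
    exact this
  mean := by simp [gam]
  var := by
    have := variance_fun_id_gaussianReal (μ := 0) (v := 1)
    rw [variance_of_integral_eq_zero (by fun_prop) (by simp)] at this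
    simpa [gam] using this
  third := le_rfl

lemma swap1 {μ : Measure ℝ} [IsProbabilityMeasure μ] {ρ : ℝ} (hμ : Mom μ ρ)
    {f f1 f2 f3 : ℝ → ℝ} (h1 : ∀ x, HasDerivAt f (f1 x) x)
    (h2 : ∀ x, HasDerivAt f1 (f2 x) x) (h3 : ∀ x, HasDerivAt f2 (f3 x) x) {K B : ℝ}
    (hK : ∀ x, |f3 x| ≤ K) (hB : ∀ x, |f x| ≤ B) (x : ℝ) :
    |∫ u, f (x - u) ∂μ - (f x + f2 x / 2)| ≤ K * ρ := by
  have hc : Continuous f := continuous_iff_continuousAt.2 fun x => (h1 x).continuousAt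
  have hi : Integrable (fun u => f (x - u)) μ :=
    Integrable.of_bound (C := B) (by fun_prop) (Eventually.of_forall fun u => hB _)
  have hK0 : 0 ≤ K := (abs_nonneg _).trans (hK 0)
  have i1 : Integrable (fun u => u * f1 x) μ := hμ.int1.mul_const _
  have i2 : Integrable (fun u => u ^ 2 / 2 * f2 x) μ := (hμ.int2.div_const 2).mul_const _
  have i0 : Integrable (fun u : ℝ => f x - u * f1 x) μ := (integrable_const _).sub i1
  have i3 : Integrable (fun u : ℝ => f x - u * f1 x + u ^ 2 / 2 * f2 x) μ := i0.add i2
  have e : ∫ u, (f x - u * f1 x + u ^ 2 / 2 * f2 x) ∂μ = f x + f2 x / 2 := by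
    rw [integral_add i0 i2, integral_sub (integrable_const _) i1, integral_mul_const,
      integral_mul_const, integral_div, hμ.mean, hμ.var]
    simp; ring
  rw [← e, ← integral_sub hi i3]
  calc _ ≤ ∫ u, |f (x - u) - (f x - u * f1 x + u ^ 2 / 2 * f2 x)| ∂μ := abs_integral_le_integral_abs
    _ ≤ ∫ u, K * |u| ^ 3 ∂μ := integral_mono (hi.sub i3).abs (hμ.int3.const_mul K)
        (fun u => taylor h1 h2 h3 hK x u)
    _ = K * ∫ u, |u| ^ 3 ∂μ := integral_const_mul _ _
    _ ≤ K * ρ := mul_le_mul_of_nonneg_left hμ.third hK0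

lemma swap2 {μ ν : Measure ℝ} [IsProbabilityMeasure μ] [IsProbabilityMeasure ν] {ρ : ℝ}
    (hμ : Mom μ ρ) (hν : Mom ν ρ)
    {f f1 f2 f3 : ℝ → ℝ} (h1 : ∀ x, HasDerivAt f (f1 x) x)
    (h2 : ∀ x, HasDerivAt f1 (f2 x) x) (h3 : ∀ x, HasDerivAt f2 (f3 x) x) {K B : ℝ}
    (hK : ∀ x, |f3 x| ≤ K) (hB : ∀ x, |f x| ≤ B) (x : ℝ) :
    |∫ u, f (x - u) ∂μ - ∫ u, f (x - u) ∂ν| ≤ 2 * (K * ρ) := by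
  have a := abs_le.1 (swap1 hμ h1 h2 h3 hK hB x)
  have b := abs_le.1 (swap1 hν h1 h2 h3 hK hB x)
  rw [abs_le]
  constructor <;> linarith [a.1, a.2, b.1, b.2]

/-- differentiation under the integral -/
lemma deriv_int {P : Measure ℝ} [IsProbabilityMeasure P] {f f' : ℝ → ℝ}
    (hd : ∀ x, HasDerivAt f (f' x) x) (hc' : Continuous f') {B B' : ℝ}
    (hB : ∀ x, |f x| ≤ B) (hB' : ∀ x, |f' x| ≤ B') (y : ℝ) :
    HasDerivAt (fun y => ∫ s, f (y - s) ∂P) (∫ s, f' (y - s) ∂P) y := by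
  have hc : Continuous f := continuous_iff_continuousAt.2 fun x => (hd x).continuousAt
  refine (hasDerivAt_integral_of_dominated_loc_of_deriv_le (F := fun y s => f (y - s))
    (F' := fun y s => f' (y - s)) (bound := fun _ => B') (s := univ) univ_mem ?_ ?_ ?_ ?_ ?_ ?_).2
  · exact Eventually.of_forall fun x => by fun_prop
  · exact Integrable.of_bound (C := B) (by fun_prop) (Eventually.of_forall fun u => hB _)
  · fun_prop
  · exact Eventually.of_forall fun a x _ => hB' _
  · exact integrable_const _
  · exact Eventually.of_forall fun a x _ => by simpa using (hd (x - a)).comp_sub_const x a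

/-- integration by parts -/
lemma by_parts {P : Measure ℝ} [IsProbabilityMeasure P] {f f' : ℝ → ℝ}
    (hf' : Integrable f') (hr : ∀ x, f x = ∫ z in Iic x, f' z) (y : ℝ) :
    ∫ s, f (y - s) ∂P = ∫ z, f' z * F P (y - z) := by
  have hS : MeasurableSet {p : ℝ × ℝ | p.2 ≤ y - p.1} :=
    measurableSet_le (by fun_prop) (by fun_prop)
  have hint : Integrable (fun p : ℝ × ℝ => indicator {p : ℝ × ℝ | p.2 ≤ y - p.1}
      (fun p => f' p.2) p) (P.prod volume) := (hf'.comp_snd P).indicator hS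
  calc ∫ s, f (y - s) ∂P
      = ∫ s, (∫ z, indicator {p : ℝ × ℝ | p.2 ≤ y - p.1} (fun p => f' p.2) (s, z)) ∂P := by
        refine integral_congr_ae (Eventually.of_forall fun s => ?_)
        simp only
        rw [hr, ← integral_indicator measurableSet_Iic]
        rfl
    _ = ∫ z, ∫ s, indicator {p : ℝ × ℝ | p.2 ≤ y - p.1} (fun p => f' p.2) (s, z) ∂P :=
        integral_integral_swap hint
    _ = _ := by
        refine integral_congr_ae (Eventually.of_forall fun z => ?_)
        simp only
        have : (fun s => indicator {p : ℝ × ℝ | p.2 ≤ y - p.1} (fun p => f' p.2) (s, z))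
            = indicator (Iic (y - z)) (fun _ => f' z) := by
          ext s
          simp only [indicator, mem_ofPred_eq, mem_Iic]
          congr 1
          rw [eq_iff_iff]
          constructor <;> intro h <;> linarith
        rw [this, integral_indicator measurableSet_Iic]
        simp [F, mul_comm]

lemma by_parts_bound {P Q : Measure ℝ} [IsProbabilityMeasure P] [IsProbabilityMeasure Q]
    {f f' : ℝ → ℝ} (hf' : Integrable f') (hr : ∀ x, f x = ∫ z in Iic x, f' z) {δ : ℝ}
    (hδ : ∀ x, |F P x - F Q x| ≤ δ) (y : ℝ) :
    |∫ s, f (y - s) ∂P - ∫ s, f (y - s) ∂Q| ≤ δ * ∫ z, |f' z| := by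
  rw [by_parts hf' hr, by_parts hf' hr]
  have hi : ∀ (P : Measure ℝ) [IsProbabilityMeasure P],
      Integrable (fun z => f' z * F P (y - z)) := fun P _ => by
    refine hf'.mul_bdd (c := 1) ((F_meas P).comp (by fun_prop)).aestronglyMeasurable
      (Eventually.of_forall fun z => ?_)
    rw [Real.norm_eq_abs, abs_of_nonneg (F_nonneg _ _)]
    exact F_le_one _ _
  rw [← integral_sub (hi P) (hi Q), ← integral_const_mul]
  refine abs_integral_le_integral_abs.trans (integral_mono ((hi P).sub (hi Q)).abs
    (hf'.abs.const_mul δ) fun z => ?_)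
  simp only
  rw [← mul_sub, abs_mul, mul_comm]
  gcongr
  exact hδ _


noncomputable def kap : ℝ := ∫ z, |ph3 z|

lemma kap_nonneg : 0 ≤ kap := integral_nonneg fun _ => abs_nonneg _

lemma cont_of_deriv {f f' : ℝ → ℝ} (hd : ∀ x, HasDerivAt f (f' x) x) : Continuous f :=
  continuous_iff_continuousAt.2 fun x => (hd x).continuousAt

lemma cdf_bound (x : ℝ) : |stdNormalCDF x| ≤ 1 := by
  rw [← F_gam_one, abs_of_nonneg (F_nonneg _ _)]
  exact F_le_one _ _

section scaled
variable (s : ℝ)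

noncomputable def s0 (y : ℝ) : ℝ := stdNormalCDF (y / s) / 1
noncomputable def s1 (y : ℝ) : ℝ := ph (y / s) / (1 * s)
noncomputable def s2 (y : ℝ) : ℝ := ph1 (y / s) / (1 * s * s)
noncomputable def s3 (y : ℝ) : ℝ := ph2 (y / s) / (1 * s * s * s)
noncomputable def s4 (y : ℝ) : ℝ := ph3 (y / s) / (1 * s * s * s * s)

lemma d0 (x : ℝ) : HasDerivAt (s0 s) (s1 s x) x := scaled_deriv hasDerivAt_cdf s 1 x
lemma d1 (x : ℝ) : HasDerivAt (s1 s) (s2 s x) x := scaled_deriv hasDerivAt_ph s _ x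
lemma d2 (x : ℝ) : HasDerivAt (s2 s) (s3 s x) x := scaled_deriv hasDerivAt_ph1 s _ x
lemma d3 (x : ℝ) : HasDerivAt (s3 s) (s4 s x) x := scaled_deriv hasDerivAt_ph2 s _ x

lemma c1 : Continuous (s1 s) := cont_of_deriv (d1 s)
lemma c2 : Continuous (s2 s) := cont_of_deriv (d2 s)
lemma c3 : Continuous (s3 s) := cont_of_deriv (d3 s)

lemma b0 (x : ℝ) : |s0 s x| ≤ 1 := by
  unfold s0; rw [div_one]; exact cdf_bound _

lemma scaled_bound {f : ℝ → ℝ} {B : ℝ} (hB : ∀ x, |f x| ≤ B) (c x : ℝ) :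
    |f (x / s) / c| ≤ B / |c| := by
  rw [abs_div]; gcongr; exact hB _

lemma b1 (x : ℝ) : |s1 s x| ≤ 1 / |1 * s| :=
  scaled_bound s (fun x => by rw [abs_of_nonneg (ph_nonneg x)]; exact ph_le x) _ x
lemma b2 (x : ℝ) : |s2 s x| ≤ (∫ z, |ph2 z|) / |1 * s * s| :=
  scaled_bound s (bound_of_integrable hasDerivAt_ph1 integrable_ph1 integrable_ph2) _ x
lemma b3 (x : ℝ) : |s3 s x| ≤ kap / |1 * s * s * s| :=
  scaled_bound s (bound_of_integrable hasDerivAt_ph2 integrable_ph2 integrable_ph3) _ x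

variable {s}

lemma i3 (hs : 0 < s) : Integrable (s3 s) := (integrable_ph2.comp_div hs.ne').div_const _
lemma i4 (hs : 0 < s) : Integrable (s4 s) := (integrable_ph3.comp_div hs.ne').div_const _
lemma l4 (hs : 0 < s) : ∫ z, |s4 s z| = kap / s ^ 3 := by
  unfold s4 kap
  simp_rw [abs_div]
  rw [integral_div, Measure.integral_comp_div (fun z => |ph3 z|) s, abs_of_pos hs,
    abs_of_pos (by positivity), smul_eq_mul]
  field_simp

lemma b3' (hs : 0 < s) (x : ℝ) : |s3 s x| ≤ kap / s ^ 3 := by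
  refine (b3 s x).trans (le_of_eq ?_)
  rw [abs_of_pos (by positivity), show 1 * s * s * s = s ^ 3 by ring]

variable (s) in
lemma conv_derivs (P : Measure ℝ) [IsProbabilityMeasure P] :
    (∀ y, HasDerivAt (fun y => ∫ u, s0 s (y - u) ∂P) (∫ u, s1 s (y - u) ∂P) y) ∧
    (∀ y, HasDerivAt (fun y => ∫ u, s1 s (y - u) ∂P) (∫ u, s2 s (y - u) ∂P) y) ∧
    (∀ y, HasDerivAt (fun y => ∫ u, s2 s (y - u) ∂P) (∫ u, s3 s (y - u) ∂P) y) :=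
  ⟨deriv_int (d0 s) (c1 s) (b0 s) (b1 s), deriv_int (d1 s) (c2 s) (b1 s) (b2 s),
    deriv_int (d2 s) (c3 s) (b2 s) (b3 s)⟩

end scaled

lemma F_conv_gam (P : Measure ℝ) [IsProbabilityMeasure P] {v : ℕ} (hv : 1 ≤ v) (y : ℝ) :
    F (P ∗ gam v) y = ∫ u, s0 (Real.sqrt v) (y - u) ∂P := by
  rw [Measure.conv_comm, F_conv]
  simp_rw [F_gam v hv, s0, div_one]

lemma sqrt_pos' {v : ℕ} (hv : 1 ≤ v) : 0 < Real.sqrt v := Real.sqrt_pos.2 (by exact_mod_cast hv)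

lemma abs_F_sub_le (P Q : Measure ℝ) [IsProbabilityMeasure P] [IsProbabilityMeasure Q] (y : ℝ) :
    |F P y - F Q y| ≤ 1 := by
  have := F_nonneg P y
  have := F_nonneg Q y
  have := F_le_one P y
  have := F_le_one Q y
  rw [abs_le]; constructor <;> linarith

lemma int_F (P μ : Measure ℝ) [IsProbabilityMeasure P] [IsProbabilityMeasure μ] (x : ℝ) :
    Integrable (fun u => F P (x - u)) μ := by
  refine Integrable.of_bound (C := 1) ((F_meas P).comp (by fun_prop)).aestronglyMeasurable
      (Eventually.of_forall fun z => ?_)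
  rw [Real.norm_eq_abs, abs_of_nonneg (F_nonneg _ _)]
  exact F_le_one _ _

lemma stepD {μ ν P Q : Measure ℝ} [IsProbabilityMeasure μ] [IsProbabilityMeasure ν]
    [IsProbabilityMeasure P] [IsProbabilityMeasure Q] {ρ δ : ℝ}
    (hμ : Mom μ ρ) (hν : Mom ν ρ) {v : ℕ} (hv : 1 ≤ v) (hδ : ∀ x, |F P x - F Q x| ≤ δ) (x : ℝ) :
    |(F ((P ∗ gam v) ∗ μ) x - F ((Q ∗ gam v) ∗ μ) x) -
      (F ((P ∗ gam v) ∗ ν) x - F ((Q ∗ gam v) ∗ ν) x)| ≤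
      2 * (δ * (kap / Real.sqrt v ^ 3) * ρ) := by
  have hs := sqrt_pos' hv
  obtain ⟨p0, p1, p2⟩ := conv_derivs (Real.sqrt v) P
  obtain ⟨q0, q1, q2⟩ := conv_derivs (Real.sqrt v) Q
  have hb : ∀ y, |∫ u, s3 (Real.sqrt v) (y - u) ∂P - ∫ u, s3 (Real.sqrt v) (y - u) ∂Q| ≤
      δ * (kap / Real.sqrt v ^ 3) := fun y => by
    rw [← l4 hs]
    exact by_parts_bound (i4 hs) (rep_of_integrable (d3 _) (i3 hs) (i4 hs)) hδ y
  have := swap2 hμ hν (fun y => (p0 y).sub (q0 y)) (fun y => (p1 y).sub (q1 y))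
    (fun y => (p2 y).sub (q2 y)) hb (B := 1) (fun y => by
      simp only [Pi.sub_apply]
      rw [← F_conv_gam P hv, ← F_conv_gam Q hv]; exact abs_F_sub_le _ _ _) x
  simp only [Pi.sub_apply] at this
  simp_rw [← F_conv_gam P hv, ← F_conv_gam Q hv] at this
  rw [integral_sub (int_F _ _ _) (int_F _ _ _), integral_sub (int_F _ _ _) (int_F _ _ _)] at this
  simp_rw [← F_conv] at this
  exact this

lemma stepG {μ ν : Measure ℝ} [IsProbabilityMeasure μ] [IsProbabilityMeasure ν] {ρ : ℝ}
    (hμ : Mom μ ρ) (hν : Mom ν ρ) {v : ℕ} (hv : 1 ≤ v) (x : ℝ) :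
    |F (gam v ∗ μ) x - F (gam v ∗ ν) x| ≤ 2 * (kap / Real.sqrt v ^ 3 * ρ) := by
  have hs := sqrt_pos' hv
  have := swap2 hμ hν (d0 _) (d1 _) (d2 _) (b3' hs) (b0 _) x
  have e : ∀ y, s0 (Real.sqrt v) y = F (gam v) y := fun y => by
    rw [F_gam v hv, s0, div_one]
  simp_rw [e] at this
  simp_rw [← F_conv] at this
  exact this

/-- convolution powers -/
noncomputable def cp (μ : Measure ℝ) : ℕ → Measure ℝ
  | 0 => Measure.dirac 0
  | (k + 1) => cp μ k ∗ μ

instance cp_prob (μ : Measure ℝ) [IsProbabilityMeasure μ] (k : ℕ) :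
    IsProbabilityMeasure (cp μ k) := by
  induction k with
  | zero => unfold cp; infer_instance
  | succ k ih => unfold cp; infer_instance

lemma step {μ : Measure ℝ} [IsProbabilityMeasure μ] {ρ δ : ℝ}
    (hμ : Mom μ ρ) (hν : Mom (gam 1) ρ) {k v : ℕ} (hv : 1 ≤ v)
    (hδ : ∀ x, |F (cp μ k) x - F (gam k) x| ≤ δ) (x : ℝ) :
    |F (cp μ (k + 1) ∗ gam v) x - F (cp μ k ∗ gam (v + 1)) x| ≤
      2 * (δ * (kap / Real.sqrt v ^ 3) * ρ) + 2 * (kap / Real.sqrt ((k + v : ℕ) : ℝ) ^ 3 * ρ) := by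
  have e1 : cp μ (k + 1) ∗ gam v = (cp μ k ∗ gam v) ∗ μ := by
    rw [cp, Measure.conv_assoc, Measure.conv_comm μ, Measure.conv_assoc]
  have e2 : cp μ k ∗ gam (v + 1) = (cp μ k ∗ gam v) ∗ gam 1 := by
    rw [Measure.conv_assoc, gam_conv]
  have a := abs_le.1 (stepD hμ hν hv hδ x)
  have b := abs_le.1 (stepG hμ hν (v := k + v) (by omega) x)
  rw [gam_conv] at a
  rw [e1, e2, abs_le]
  constructor <;> linarith [a.1, a.2, b.1, b.2]

/-- smoothing inequality -/
lemma smoothing {P Q : Measure ℝ} [IsProbabilityMeasure P] [IsProbabilityMeasure Q] {L τ : ℝ}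
    (hL : ∀ x y, x ≤ y → F Q y - F Q x ≤ L * (y - x)) {a : ℕ} (ha : 1 ≤ a)
    (hτ : ∀ x, |F (P ∗ gam a) x - F (Q ∗ gam a) x| ≤ τ) (x : ℝ) :
    |F P x - F Q x| ≤ 2 * τ + 16 * L * Real.sqrt a := by
  set r := 2 * Real.sqrt a with hr
  have hs := sqrt_pos' ha
  have hrp : 0 < r := by positivity
  have hL0 : 0 ≤ L := by
    have := hL 0 1 (by norm_num)
    have := F_mono Q (show (0:ℝ) ≤ 1 by norm_num)
    linarith
  set p := (gam a).real {z | |z| ≤ r} with hp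
  have hS : MeasurableSet {z : ℝ | |z| ≤ r} := measurableSet_le (by fun_prop) (by fun_prop)
  have hp34 : 3 / 4 ≤ p := by
    have hch := meas_ge_le_variance_div_sq (μ := gam a) (X := id)
      (memLp_id_gaussianReal 2) (c := r) hrp
    have hv : Var[id; gam a] = a := by unfold gam; rw [variance_id_gaussianReal]; simp
    have hm : ∫ z, id z ∂(gam a) = 0 := by simp [gam]
    rw [hv, hm] at hch
    have hq : (a : ℝ) / r ^ 2 = 1 / 4 := by
      rw [hr, mul_pow, Real.sq_sqrt (by positivity)]
      have : (a : ℝ) ≠ 0 := by positivity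
      field_simp; norm_num
    rw [hq] at hch
    have h1 : (gam a).real {z | |z| ≤ r}ᶜ ≤ 1 / 4 := by
      refine ENNReal.toReal_le_of_le_ofReal (by norm_num) (le_trans (measure_mono ?_) hch)
      intro z hz
      have : r < |z| := not_le.1 hz
      show r ≤ |id z - 0|
      simpa using this.le
    rw [probReal_compl_eq_one_sub hS] at h1
    linarith
  have hp1 : p ≤ 1 := measureReal_le_one
  let Δ : ℝ → ℝ := fun x => F P x - F Q x
  have hΔ1 : ∀ x, |Δ x| ≤ 1 := abs_F_sub_le P Q
  have hbdd : BddAbove (range fun x => |Δ x|) := ⟨1, by rintro _ ⟨x, rfl⟩; exact hΔ1 x⟩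
  set D := ⨆ x, |Δ x| with hD
  have hDx : ∀ x, |Δ x| ≤ D := fun x => le_ciSup hbdd x
  have hD0 : 0 ≤ D := (abs_nonneg _).trans (hDx 0)
  have hconv : ∀ x, |∫ z, Δ (x - z) ∂(gam a)| ≤ τ := fun x => by
    have := hτ x
    rw [F_conv, F_conv, ← integral_sub (int_F _ _ _) (int_F _ _ _)] at this
    exact this
  have hint : ∀ x, Integrable (fun z => Δ (x - z)) (gam a) := fun x =>
    (int_F P _ x).sub (int_F Q _ x)
  have hlow : ∀ c : ℝ, ∫ z, (indicator {z | |z| ≤ r} (fun _ => c + D) z - D) ∂(gam a)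
      = (c + D) * p - D := fun c => by
    rw [integral_sub ((integrable_const _).indicator hS) (integrable_const _),
      integral_indicator hS]
    simp [hp, mul_comm]
  have hlint : ∀ c : ℝ, Integrable (fun z => indicator {z | |z| ≤ r} (fun _ => c + D) z - D)
      (gam a) := fun c => ((integrable_const _).indicator hS).sub (integrable_const _)
  have key : ∀ x, |Δ x| * p ≤ τ + 2 * r * L * p + D * (1 - p) := by
    intro x
    have up : Δ x * p ≤ τ + 2 * r * L * p + D * (1 - p) := by
      have h := integral_mono (hlint (Δ x - 2 * r * L)) (hint (x + r)) (fun z => by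
        simp only [indicator, mem_ofPred_eq]
        split_ifs with hz
        · have hz' := abs_le.1 hz
          have h1 := F_mono P (show x ≤ x + r - z by linarith)
          have h2 := hL x (x + r - z) (by linarith)
          have h3 : L * (x + r - z - x) ≤ L * (2 * r) := by gcongr; linarith
          simp only [Δ]
          linarith
        · have := (abs_le.1 (hDx (x + r - z))).1
          linarith)
      rw [hlow] at h
      have := (abs_le.1 (hconv (x + r))).2
      nlinarith
    have dn : -Δ x * p ≤ τ + 2 * r * L * p + D * (1 - p) := by
      have h := integral_mono (hlint (-Δ x - 2 * r * L)) (hint (x - r)).neg (fun z => by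
        simp only [indicator, mem_ofPred_eq, Pi.neg_apply]
        split_ifs with hz
        · have hz' := abs_le.1 hz
          have h1 := F_mono P (show x - r - z ≤ x by linarith)
          have h2 := hL (x - r - z) x (by linarith)
          have h3 : L * (x - (x - r - z)) ≤ L * (2 * r) := by gcongr; linarith
          simp only [Δ]
          linarith
        · have := (abs_le.1 (hDx (x - r - z))).2
          linarith)
      rw [hlow] at h
      simp only [Pi.neg_apply] at h
      rw [integral_neg] at h
      have := (abs_le.1 (hconv (x - r))).1
      nlinarith
    rcases abs_cases (Δ x) with h | h <;> rw [h.1]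
    · exact up
    · exact dn
  have hDp : D ≤ (τ + 2 * r * L * p + D * (1 - p)) / p :=
    ciSup_le fun x => by rw [le_div_iff₀ (by linarith)]; exact key x
  rw [le_div_iff₀ (by linarith)] at hDp
  have hrL : 0 ≤ r * L := by positivity
  have h4 : D ≤ 2 * τ + 4 * (r * L * p) := by nlinarith
  have h5 : r * L * p ≤ r * L * 1 := by gcongr
  refine (hDx x).trans (h4.trans ?_)
  rw [hr] at h5 ⊢
  nlinarith

lemma sum_inv_sqrt (n : ℕ) : ∑ k ∈ Finset.range n, 1 / Real.sqrt ((k + 1 : ℕ) : ℝ) ≤ 2 * Real.sqrt n := by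
  induction n with
  | zero => simp
  | succ n ih =>
    rw [Finset.sum_range_succ]
    have h1 : 0 < Real.sqrt ((n + 1 : ℕ) : ℝ) := sqrt_pos' (by omega)
    have h0 : 0 ≤ Real.sqrt (n : ℝ) := Real.sqrt_nonneg _
    have e1 := Real.sq_sqrt (show (0:ℝ) ≤ ((n + 1 : ℕ) : ℝ) by positivity)
    have e0 := Real.sq_sqrt (show (0:ℝ) ≤ (n : ℝ) by positivity)
    push_cast at *
    have : 1 / Real.sqrt ((n:ℝ) + 1) ≤ 2 * (Real.sqrt ((n:ℝ) + 1) - Real.sqrt n) := by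
      rw [div_le_iff₀ h1]
      nlinarith [sq_nonneg (Real.sqrt ((n:ℝ) + 1) - Real.sqrt n)]
    linarith

lemma sum_inv_cube {a : ℕ} (ha : 1 ≤ a) (n : ℕ) :
    ∑ k ∈ Finset.range n, (1 / Real.sqrt ((k + a : ℕ) : ℝ)) ^ 3 ≤
      4 * (1 / Real.sqrt a - 1 / Real.sqrt ((n + a : ℕ) : ℝ)) := by
  induction n with
  | zero => simp
  | succ n ih =>
    rw [Finset.sum_range_succ]
    set m := n + a with hm
    have hm1 : 1 ≤ m := by omega
    have : n + 1 + a = m + 1 := by omega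
    rw [this]
    have key : (1 / Real.sqrt (m : ℝ)) ^ 3 ≤
        4 * (1 / Real.sqrt (m : ℝ) - 1 / Real.sqrt ((m + 1 : ℕ) : ℝ)) := by
      have hm1' : (1:ℝ) ≤ m := by exact_mod_cast hm1
      have h0 : 0 < Real.sqrt (m : ℝ) := sqrt_pos' hm1
      have h1 : 0 < Real.sqrt ((m + 1 : ℕ) : ℝ) := sqrt_pos' (by omega)
      have e1 := Real.sq_sqrt (show (0:ℝ) ≤ ((m + 1 : ℕ) : ℝ) by positivity)
      have e0 := Real.sq_sqrt (show (0:ℝ) ≤ (m : ℝ) by positivity)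
      set x := Real.sqrt (m : ℝ)
      set y := Real.sqrt ((m + 1 : ℕ) : ℝ)
      push_cast at e1
      have hxy : y ^ 2 = x ^ 2 + 1 := by rw [e1, e0]
      have hx1 : 1 ≤ x ^ 2 := by rw [e0]; exact hm1'
      have hy : y ≤ 3 / 2 * x := by
        refine abs_le_of_sq_le_sq' ?_ (by positivity) |>.2
        nlinarith
      have hmul : (y - x) * (y + x) = 1 := by nlinarith
      have hyx : y - x = 1 / (y + x) := by rw [eq_div_iff (by positivity)]; exact hmul
      have e : 1 / x - 1 / y = 1 / (x * y * (y + x)) := by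
        rw [div_sub_div _ _ h0.ne' h1.ne', one_mul, mul_one, hyx, div_div, mul_comm (y + x)]
      rw [e, one_div, inv_pow, ← one_div, mul_one_div, div_le_div_iff₀ (by positivity) (by positivity)]
      have : y * (y + x) ≤ 3 / 2 * x * (3 / 2 * x + x) := by gcongr
      nlinarith [mul_le_mul_of_nonneg_left this h0.le]
    linarith

lemma pq_le {k m : ℝ} (hk : 0 ≤ k) (hm : 0 < m) :
    1 / Real.sqrt k * (1 / Real.sqrt m) ≤
      1 / Real.sqrt (k + m) * (1 / Real.sqrt k + 1 / Real.sqrt m) := by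
  rcases hk.eq_or_lt with rfl | hk
  · simp only [Real.sqrt_zero, div_zero, zero_mul, zero_add]
    positivity
  have hx := Real.sqrt_pos.2 hk
  have hy := Real.sqrt_pos.2 hm
  have hz := Real.sqrt_pos.2 (add_pos hk hm)
  have hle : Real.sqrt (k + m) ≤ Real.sqrt k + Real.sqrt m := by
    rw [Real.sqrt_le_left (by positivity)]
    nlinarith [Real.sq_sqrt hk.le, Real.sq_sqrt hm.le]
  rw [div_add_div _ _ hx.ne' hy.ne', div_mul_div_comm, div_mul_div_comm,
    div_le_div_iff₀ (by positivity) (by positivity)]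
  have : 0 < Real.sqrt k * Real.sqrt m := by positivity
  nlinarith

lemma sum_main {a n : ℕ} (ha : 1 ≤ a) (hn : 1 ≤ n) :
    ∑ k ∈ Finset.range n, 1 / Real.sqrt k * (1 / Real.sqrt ((n - 1 - k + a : ℕ) : ℝ)) ^ 3 ≤
      8 / (Real.sqrt n * Real.sqrt a) := by
  set w := 1 / Real.sqrt ((n - 1 + a : ℕ) : ℝ) with hw
  set b := 1 / Real.sqrt (a : ℝ) with hb
  have hb0 : 0 ≤ b := by positivity
  have hw0 : 0 ≤ w := by positivity
  have hsn := sqrt_pos' hn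
  have hwn : w ≤ 1 / Real.sqrt n := by
    rw [hw]; gcongr; omega
  let p : ℕ → ℝ := fun k => 1 / Real.sqrt (k : ℝ)
  let q : ℕ → ℝ := fun k => 1 / Real.sqrt ((n - 1 - k + a : ℕ) : ℝ)
  have hterm : ∀ k ∈ Finset.range n, p k * q k ^ 3 ≤ w ^ 2 * b * (p k + q k) + w * q k ^ 3 := by
    intro k hk
    have hk' := Finset.mem_range.1 hk
    have hp0 : 0 ≤ p k := by positivity
    have hq0 : 0 ≤ q k := by positivity
    have hqb : q k ≤ b := by
      simp only [q, hb]
      have := sqrt_pos' ha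
      gcongr; omega
    have hpq : p k * q k ≤ w * (p k + q k) := by
      have := pq_le (k := (k : ℝ)) (m := ((n - 1 - k + a : ℕ) : ℝ)) (by positivity)
        (by have : 0 < n - 1 - k + a := by omega
            exact_mod_cast this)
      have e : (k : ℝ) + ((n - 1 - k + a : ℕ) : ℝ) = ((n - 1 + a : ℕ) : ℝ) := by
        rw [← Nat.cast_add]; congr 1; omega
      rw [e] at this
      exact this
    calc p k * q k ^ 3 = q k ^ 2 * (p k * q k) := by ring
      _ ≤ q k ^ 2 * (w * (p k + q k)) := by gcongr
      _ = w * q k * (p k * q k) + w * q k ^ 3 := by ring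
      _ ≤ w * b * (w * (p k + q k)) + w * q k ^ 3 := by gcongr
      _ = _ := by ring
  have hp : ∑ k ∈ Finset.range n, p k ≤ 2 * Real.sqrt n := by
    obtain ⟨m, rfl⟩ : ∃ m, n = m + 1 := ⟨n - 1, by omega⟩
    rw [Finset.sum_range_succ']
    have := sum_inv_sqrt m
    have h2 : Real.sqrt (m : ℝ) ≤ Real.sqrt ((m + 1 : ℕ) : ℝ) := by gcongr; omega
    simp only [p]
    simp only [CharP.cast_eq_zero, Real.sqrt_zero, div_zero, add_zero]
    linarith
  have hq : ∑ k ∈ Finset.range n, q k ≤ 2 * Real.sqrt n := by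
    rw [← Finset.sum_range_reflect]
    refine le_trans (Finset.sum_le_sum fun k hk => ?_) (sum_inv_sqrt n)
    have hk' := Finset.mem_range.1 hk
    simp only [q]
    have : 0 < Real.sqrt ((k + 1 : ℕ) : ℝ) := sqrt_pos' (by omega)
    gcongr
    omega
  have hq3 : ∑ k ∈ Finset.range n, q k ^ 3 ≤ 4 * b := by
    rw [← Finset.sum_range_reflect]
    have h := sum_inv_cube ha n
    have h' : 0 ≤ 1 / Real.sqrt ((n + a : ℕ) : ℝ) := by positivity
    refine le_trans (le_of_eq (Finset.sum_congr rfl fun k hk => ?_)) (h.trans (by linarith))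
    have hk' := Finset.mem_range.1 hk
    simp only [q]
    congr 5
    omega
  have h1 := Finset.sum_le_sum hterm
  rw [Finset.sum_add_distrib, ← Finset.mul_sum, ← Finset.mul_sum, Finset.sum_add_distrib] at h1
  refine h1.trans ?_
  calc w ^ 2 * b * (∑ k ∈ Finset.range n, p k + ∑ k ∈ Finset.range n, q k)
        + w * ∑ k ∈ Finset.range n, q k ^ 3
      ≤ (1 / Real.sqrt n) ^ 2 * b * (2 * Real.sqrt n + 2 * Real.sqrt n)
        + (1 / Real.sqrt n) * (4 * b) := by gcongr
    _ = 8 / (Real.sqrt n * Real.sqrt a) := by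
        have := sqrt_pos' ha
        rw [hb]; field_simp; norm_num


lemma Mom.mono {μ : Measure ℝ} {ρ ρ' : ℝ} (h : Mom μ ρ) (hle : ρ ≤ ρ') : Mom μ ρ' :=
  ⟨h.int3, h.int2, h.int1, h.mean, h.var, h.third.trans hle⟩

lemma gam_lip {n : ℕ} (hn : 1 ≤ n) (x y : ℝ) (hxy : x ≤ y) :
    F (gam n) y - F (gam n) x ≤ 1 / Real.sqrt n * (y - x) := by
  have hs := sqrt_pos' hn
  have e : ∀ y, F (gam n) y = s0 (Real.sqrt n) y := fun y => by
    rw [F_gam n hn, s0, div_one]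
  rw [e, e]
  have := convex_univ.norm_image_sub_le_of_norm_hasDerivWithin_le (f := s0 (Real.sqrt n))
    (f' := s1 (Real.sqrt n)) (C := 1 / Real.sqrt n) (x := x) (y := y)
    (fun z _ => (d0 _ z).hasDerivWithinAt) (fun z _ => by
      have := b1 (Real.sqrt n) z
      rwa [one_mul, abs_of_pos hs] at this) (mem_univ _) (mem_univ _)
  rw [Real.norm_eq_abs, Real.norm_eq_abs, abs_of_nonneg (by linarith : 0 ≤ y - x)] at this
  exact (le_abs_self _).trans this

lemma induct {μ : Measure ℝ} [IsProbabilityMeasure μ] {ρ C : ℝ} (hC : 0 ≤ C)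
    (hμ : Mom μ ρ) (hν : Mom (gam 1) ρ) {a n : ℕ} (ha : 1 ≤ a) (hn : 1 ≤ n)
    (ih : ∀ k < n, ∀ x, |F (cp μ k) x - F (gam k) x| ≤ C / Real.sqrt k) (x : ℝ) :
    |F (cp μ n) x - F (gam n) x| ≤
      (4 * kap * ρ * (8 * C / Real.sqrt a + 1) + 16 * Real.sqrt a) / Real.sqrt n := by
  have hsn := sqrt_pos' hn
  have hsa := sqrt_pos' ha
  have hρ : 0 ≤ ρ := le_trans (integral_nonneg fun x => by positivity) hν.third
  have hκ := kap_nonneg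
  have hτ : ∀ x, |F (cp μ n ∗ gam a) x - F (gam n ∗ gam a) x| ≤
      2 * kap * ρ * (8 * C / Real.sqrt a + 1) / Real.sqrt n := by
    intro x
    let T : ℕ → ℝ := fun k => F (cp μ k ∗ gam (n - k + a)) x
    have e0 : T 0 = F (gam n ∗ gam a) x := by
      simp only [T, cp, Measure.dirac_zero_conv, gam_conv, Nat.sub_zero]
    have en : T n = F (cp μ n ∗ gam a) x := by simp [T]
    rw [← e0, ← en, ← Finset.sum_range_sub]
    refine (Finset.abs_sum_le_sum_abs _ _).trans ?_
    have hb : ∀ k ∈ Finset.range n, |T (k + 1) - T k| ≤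
        2 * kap * ρ * C * (1 / Real.sqrt k * (1 / Real.sqrt ((n - 1 - k + a : ℕ) : ℝ)) ^ 3)
          + 2 * kap * ρ * (1 / Real.sqrt n ^ 3) := by
      intro k hk
      have hk' := Finset.mem_range.1 hk
      have h := step hμ hν (k := k) (v := n - 1 - k + a) (by omega) (ih k hk') x
      have f1 : n - (k + 1) + a = n - 1 - k + a := by omega
      have f2 : n - k + a = n - 1 - k + a + 1 := by omega
      simp only [T]
      rw [f1, f2]
      refine h.trans (add_le_add (le_of_eq (by ring)) ?_)
      have f3 : n ≤ k + (n - 1 - k + a) := by omega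
      have f4 : Real.sqrt n ≤ Real.sqrt ((k + (n - 1 - k + a) : ℕ) : ℝ) :=
        Real.sqrt_le_sqrt (by exact_mod_cast f3)
      calc 2 * (kap / Real.sqrt ((k + (n - 1 - k + a) : ℕ) : ℝ) ^ 3 * ρ)
          ≤ 2 * (kap / Real.sqrt n ^ 3 * ρ) := by gcongr
        _ = _ := by ring
    refine (Finset.sum_le_sum hb).trans ?_
    rw [Finset.sum_add_distrib, ← Finset.mul_sum, Finset.sum_const, Finset.card_range, nsmul_eq_mul]
    have hsm := sum_main ha hn
    have hn2 := Real.sq_sqrt (show (0:ℝ) ≤ n by positivity)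
    calc _ ≤ 2 * kap * ρ * C * (8 / (Real.sqrt n * Real.sqrt a))
          + Real.sqrt n ^ 2 * (2 * kap * ρ * (1 / Real.sqrt n ^ 3)) := by
            rw [hn2]; gcongr
      _ = _ := by field_simp
  have := smoothing (gam_lip hn) ha hτ x
  refine this.trans (le_of_eq ?_)
  field_simp
  ring

theorem berry_esseen (ρ : ℝ) : ∃ C : ℝ, 0 < C ∧ ∀ (μ : Measure ℝ) [IsProbabilityMeasure μ],
    Mom μ ρ → ∀ (n : ℕ) (x : ℝ), |F (cp μ n) x - F (gam n) x| ≤ C / Real.sqrt n := by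
  set ρ' := max ρ (∫ x, |x| ^ 3 ∂(gam 1)) with hρ'
  have hν : Mom (gam 1) ρ' := mom_gam.mono (le_max_right _ _)
  have hρ : 0 ≤ ρ' := le_trans (integral_nonneg fun x => by positivity) hν.third
  have hκ := kap_nonneg
  obtain ⟨m, hm⟩ := exists_nat_ge (64 * kap * ρ')
  set a : ℕ := (m + 1) ^ 2 with ha
  have ha1 : 1 ≤ a := Nat.one_le_pow _ _ (by omega)
  have hsa : Real.sqrt a = m + 1 := by
    rw [ha]; push_cast; exact Real.sqrt_sq (by positivity)
  set C := 2 * (4 * kap * ρ' + 16 * Real.sqrt a) with hCdef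
  have hsp := sqrt_pos' ha1
  have hC : 0 < C := by positivity
  refine ⟨C, hC, fun μ _ hμ n => ?_⟩
  have hμ' := hμ.mono (le_max_left ρ (∫ x, |x| ^ 3 ∂(gam 1)))
  induction n using Nat.strong_induction_on with
  | _ n ih =>
    intro x
    rcases Nat.eq_zero_or_pos n with rfl | hn
    · simp [cp, gam_zero]
    · refine (induct hC.le hμ' hν ha1 hn ih x).trans ?_
      gcongr
      have h1 : 32 * kap * ρ' * C / Real.sqrt a ≤ C / 2 := by
        rw [div_le_iff₀ hsp, hsa]
        nlinarith
      have h2 : 4 * kap * ρ' * (8 * C / Real.sqrt a + 1) + 16 * Real.sqrt a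
          = 32 * kap * ρ' * C / Real.sqrt a + C / 2 := by rw [hCdef]; field_simp; ring
      rw [h2]; linarith


section tkf
variable {lam t : ℝ}

lemma beta_pos (lam t : ℝ) : 0 < betaTKF lam t := Real.exp_pos _

lemma beta_lt (ht : 0 < t) (h1 : lam < 1) : betaTKF lam t < 1 := by
  unfold betaTKF
  rw [Real.exp_lt_one_iff]
  nlinarith

lemma beta_ge (ht : 0 < t) (h0 : 0 < lam) : Real.exp (-t) ≤ betaTKF lam t := by
  unfold betaTKF
  apply Real.exp_le_exp.2
  nlinarith

lemma den_pos (ht : 0 < t) (h0 : 0 < lam) (h1 : lam < 1) : 0 < 1 - lam * betaTKF lam t := by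
  have := beta_lt ht h1
  have := beta_pos lam t
  nlinarith

lemma den_le (h0 : 0 < lam) (h1 : lam < 1) (ht : 0 < t) :
    1 - lam * betaTKF lam t ≤ (1 - lam) * (1 + t) := by
  have h : -(1 - lam) * t + 1 ≤ betaTKF lam t := Real.add_one_le_exp _
  have : 0 < (1 - lam) * t := mul_pos (by linarith) ht
  nlinarith

lemma eta_eq (lam t : ℝ) : eta lam t = (1 - betaTKF lam t) / (1 - lam * betaTKF lam t) := rfl

lemma one_sub_q (ht : 0 < t) (h0 : 0 < lam) (h1 : lam < 1) :
    1 - lam * eta lam t = (1 - lam) / (1 - lam * betaTKF lam t) := by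
  have := den_pos ht h0 h1
  rw [eta_eq]; field_simp; ring

lemma one_sub_eta (ht : 0 < t) (h0 : 0 < lam) (h1 : lam < 1) :
    1 - eta lam t = betaTKF lam t * (1 - lam * eta lam t) := by
  have := den_pos ht h0 h1
  rw [one_sub_q ht h0 h1, eta_eq, eq_comm, ← mul_div_assoc, div_eq_iff this.ne', sub_mul,
    div_mul_cancel₀ _ this.ne']
  ring

lemma one_sub_q_ge (ht : 0 < t) (h0 : 0 < lam) (h1 : lam < 1) :
    1 / (1 + t) ≤ 1 - lam * eta lam t := by
  rw [one_sub_q ht h0 h1, div_le_div_iff₀ (by linarith) (den_pos ht h0 h1)]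
  have := den_le h0 h1 ht
  linarith

lemma eta_ge (ht : 0 < t) (h0 : 0 < lam) (h1 : lam < 1) :
    t * Real.exp (-t) / (1 + t) ≤ eta lam t := by
  rw [eta_eq, div_le_div_iff₀ (by linarith) (den_pos ht h0 h1)]
  have h2 := den_le h0 h1 ht
  have h3 : (1 - lam) * t * Real.exp (-t) ≤ 1 - betaTKF lam t := by
    have hb := beta_ge ht h0
    have hx : 0 < (1 - lam) * t := mul_pos (by linarith) ht
    have h4 : betaTKF lam t * ((1 - lam) * t + 1) ≤ 1 := by
      have := Real.add_one_le_exp ((1 - lam) * t)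
      calc _ ≤ betaTKF lam t * Real.exp ((1 - lam) * t) := by
            gcongr; exact (beta_pos _ _).le
        _ = 1 := by unfold betaTKF; rw [← Real.exp_add, show -(1 - lam) * t + (1 - lam) * t = 0 by ring, Real.exp_zero]
    nlinarith
  have h5 : 0 < t * Real.exp (-t) := by positivity
  nlinarith

lemma eta_pos (ht : 0 < t) (h0 : 0 < lam) (h1 : lam < 1) : 0 < eta lam t :=
  lt_of_lt_of_le (by positivity) (eta_ge ht h0 h1)

lemma q_nonneg (ht : 0 < t) (h0 : 0 < lam) (h1 : lam < 1) : 0 ≤ lam * eta lam t :=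
  mul_nonneg h0.le (eta_pos ht h0 h1).le

lemma q_lt_one (ht : 0 < t) (h0 : 0 < lam) (h1 : lam < 1) : lam * eta lam t < 1 := by
  have := one_sub_q_ge ht h0 h1
  have : 0 < 1 / (1 + t) := by positivity
  linarith

lemma q_le (ht : 0 < t) (h0 : 0 < lam) (h1 : lam < 1) : lam * eta lam t ≤ t / (1 + t) := by
  have := one_sub_q_ge ht h0 h1
  have : t / (1 + t) = 1 - 1 / (1 + t) := by field_simp; ring
  linarith

lemma eta_lt (ht : 0 < t) (h0 : 0 < lam) (h1 : lam < 1) : eta lam t < 1 := by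
  have := one_sub_eta ht h0 h1
  have := mul_pos (beta_pos lam t) (sub_pos.2 (q_lt_one ht h0 h1))
  linarith

lemma p_nonneg (ht : 0 < t) (h0 : 0 < lam) (h1 : lam < 1) (n : ℕ) : 0 ≤ pTKF lam t n := by
  have h2 := eta_pos ht h0 h1
  have h3 := eta_lt ht h0 h1
  have h4 := q_lt_one ht h0 h1
  have h5 := q_nonneg ht h0 h1
  cases n with
  | zero => exact h2.le
  | succ n =>
    exact mul_nonneg (mul_nonneg (by linarith) (by linarith)) (pow_nonneg h5 n)

/-- uniform dominating sequence -/
noncomputable def dom (t : ℝ) : ℕ → ℝ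
  | 0 => 1
  | (n + 1) => (t / (1 + t)) ^ n

lemma p_le_dom (ht : 0 < t) (h0 : 0 < lam) (h1 : lam < 1) (n : ℕ) : pTKF lam t n ≤ dom t n := by
  have h2 := eta_pos ht h0 h1
  have h3 := eta_lt ht h0 h1
  have h4 := q_lt_one ht h0 h1
  have h5 := q_nonneg ht h0 h1
  cases n with
  | zero => exact h3.le
  | succ n =>
    have h6 : (1 - eta lam t) * (1 - lam * eta lam t) ≤ 1 :=
      mul_le_one₀ (by linarith) (by linarith) (by linarith)
    calc pTKF lam t (n + 1) ≤ 1 * (lam * eta lam t) ^ n :=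
          mul_le_mul_of_nonneg_right h6 (pow_nonneg h5 n)
      _ ≤ _ := by
        rw [one_mul]; exact pow_le_pow_left₀ h5 (q_le ht h0 h1) n

lemma summable_dom (ht : 0 < t) : Summable fun n : ℕ => ((n : ℝ) + 1) ^ 3 * dom t n := by
  rw [← summable_nat_add_iff 1]
  have hr : ‖t / (1 + t)‖ < 1 := by
    rw [Real.norm_of_nonneg (by positivity), div_lt_one (by positivity)]; linarith
  have s := fun k => summable_pow_mul_geometric_of_norm_lt_one (R := ℝ) k hr
  have := ((s 3).add ((s 2).mul_left 6)).add (((s 1).mul_left 12).add ((s 0).mul_left 8))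
  refine this.congr fun n => ?_
  simp only [dom]
  push_cast
  ring

lemma summable_p (ht : 0 < t) (h0 : 0 < lam) (h1 : lam < 1) :
    Summable fun n : ℕ => ((n : ℝ) + 1) ^ 3 * pTKF lam t n :=
  Summable.of_nonneg_of_le (fun n => mul_nonneg (by positivity) (p_nonneg ht h0 h1 n))
    (fun n => mul_le_mul_of_nonneg_left (p_le_dom ht h0 h1 n) (by positivity)) (summable_dom ht)

lemma summable_of_dom (ht : 0 < t) (h0 : 0 < lam) (h1 : lam < 1) {f : ℕ → ℝ} {c : ℝ}
    (hf : ∀ n, |f n| ≤ c * ((n : ℝ) + 1) ^ 3) : Summable fun n : ℕ => pTKF lam t n * f n := by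
  refine Summable.of_norm_bounded ((summable_p ht h0 h1).mul_left c) fun n => ?_
  have := p_nonneg ht h0 h1 n
  rw [Real.norm_eq_abs, abs_mul, abs_of_nonneg this]
  nlinarith [mul_le_mul_of_nonneg_left (hf n) this]

lemma tsum_p (ht : 0 < t) (h0 : 0 < lam) (h1 : lam < 1) :
    Summable (pTKF lam t) ∧ ∑' n, pTKF lam t n = 1 := by
  have hs : Summable (pTKF lam t) := by
    have := summable_of_dom ht h0 h1 (f := fun _ => 1) (c := 1) (fun n => by
      rw [abs_one, one_mul]
      exact one_le_pow₀ (by linarith [(Nat.cast_nonneg n : (0:ℝ) ≤ n)]))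
    simpa using this
  refine ⟨hs, ?_⟩
  rw [hs.tsum_eq_zero_add]
  simp only [pTKF]
  have hq := q_lt_one ht h0 h1
  rw [tsum_mul_left, tsum_geometric_of_lt_one (q_nonneg ht h0 h1) hq]
  have : 1 - lam * eta lam t ≠ 0 := by linarith
  rw [mul_inv_cancel_right₀ this]
  ring

lemma tsum_np (ht : 0 < t) (h0 : 0 < lam) (h1 : lam < 1) :
    Summable (fun n : ℕ => pTKF lam t n * n) ∧ ∑' n : ℕ, pTKF lam t n * n = betaTKF lam t := by
  have hs : Summable (fun n : ℕ => pTKF lam t n * n) := by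
    refine summable_of_dom ht h0 h1 (c := 1) (fun n => ?_)
    have : (0:ℝ) ≤ n := Nat.cast_nonneg n
    rw [abs_of_nonneg this, one_mul]
    nlinarith [pow_nonneg this 3, pow_nonneg this 2]
  refine ⟨hs, ?_⟩
  rw [hs.tsum_eq_zero_add]
  have hq := q_lt_one ht h0 h1
  have hq0 := q_nonneg ht h0 h1
  have hn : ‖lam * eta lam t‖ < 1 := by rwa [Real.norm_of_nonneg hq0]
  have e : ∀ n : ℕ, pTKF lam t (n + 1) * ((n + 1 : ℕ) : ℝ) =
      (1 - eta lam t) * (1 - lam * eta lam t) *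
        (n * (lam * eta lam t) ^ n + (lam * eta lam t) ^ n) := fun n => by
    simp only [pTKF]; push_cast; ring
  simp_rw [e]
  rw [tsum_mul_left, ((hasSum_coe_mul_geometric_of_norm_lt_one hn).add
    (hasSum_geometric_of_lt_one hq0 hq)).tsum_eq, one_sub_eta ht h0 h1]
  have : 1 - lam * eta lam t ≠ 0 := by linarith
  simp only [CharP.cast_eq_zero, mul_zero, zero_add]
  field_simp
  ring

lemma abs_sub_beta (ht : 0 < t) (h1 : lam < 1) (n : ℕ) :
    |(n : ℝ) - betaTKF lam t| ≤ n + 1 := by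
  have := beta_pos lam t
  have := beta_lt ht h1
  have : (0:ℝ) ≤ n := Nat.cast_nonneg n
  rw [abs_le]; constructor <;> linarith

lemma summable_var (ht : 0 < t) (h0 : 0 < lam) (h1 : lam < 1) :
    Summable (fun n : ℕ => ((n : ℝ) - betaTKF lam t) ^ 2 * pTKF lam t n) := by
  have := summable_of_dom ht h0 h1 (f := fun n => ((n : ℝ) - betaTKF lam t) ^ 2) (c := 1)
    (fun n => by
      rw [abs_pow, one_mul]
      refine (pow_le_pow_left₀ (abs_nonneg _) (abs_sub_beta ht h1 n) 2).trans ?_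
      exact pow_le_pow_right₀ (by linarith [(Nat.cast_nonneg n : (0:ℝ) ≤ n)]) (by norm_num))
  exact this.congr fun n => mul_comm _ _

lemma var_ge (ht : 0 < t) (h0 : 0 < lam) (h1 : lam < 1) :
    t * Real.exp (-t) / (1 + t) * Real.exp (-t) ^ 2 ≤
      ∑' n : ℕ, ((n : ℝ) - betaTKF lam t) ^ 2 * pTKF lam t n := by
  have := (summable_var ht h0 h1).le_tsum 0
    (fun n _ => mul_nonneg (sq_nonneg _) (p_nonneg ht h0 h1 n))
  refine le_trans ?_ this
  simp only [CharP.cast_eq_zero, zero_sub, neg_sq, pTKF]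
  rw [mul_comm]
  have h2 := beta_ge ht h0
  have h3 := eta_ge ht h0 h1
  gcongr

/-- uniform lower bound for the standard deviation -/
noncomputable def sig0 (t : ℝ) : ℝ :=
  Real.sqrt (t * Real.exp (-t) / (1 + t) * Real.exp (-t) ^ 2)

lemma sig0_pos (ht : 0 < t) : 0 < sig0 t := Real.sqrt_pos.2 (by positivity)

lemma sdev_ge (ht : 0 < t) (h0 : 0 < lam) (h1 : lam < 1) : sig0 t ≤ sdev lam t :=
  Real.sqrt_le_sqrt (var_ge ht h0 h1)

lemma sdev_sq (ht : 0 < t) (h0 : 0 < lam) (h1 : lam < 1) :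
    sdev lam t ^ 2 = ∑' n : ℕ, ((n : ℝ) - betaTKF lam t) ^ 2 * pTKF lam t n :=
  Real.sq_sqrt (tsum_nonneg fun n => mul_nonneg (sq_nonneg _) (p_nonneg ht h0 h1 n))

noncomputable def pt (lam t : ℝ) (M n : ℕ) : ℝ := ((n : ℝ) - M * betaTKF lam t) / sdev lam t

/-- normalized law -/
noncomputable def law (lam t : ℝ) : Measure ℝ :=
  Measure.sum (fun n : ℕ => ENNReal.ofReal (pTKF lam t n) • Measure.dirac (pt lam t 1 n))

lemma law_prob (ht : 0 < t) (h0 : 0 < lam) (h1 : lam < 1) : IsProbabilityMeasure (law lam t) := by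
  constructor
  unfold law
  rw [Measure.sum_apply _ MeasurableSet.univ]
  simp only [Measure.smul_apply, measure_univ, smul_eq_mul, mul_one]
  obtain ⟨hs, he⟩ := tsum_p ht h0 h1
  rw [← ENNReal.ofReal_tsum_of_nonneg (p_nonneg ht h0 h1) hs, he, ENNReal.ofReal_one]

lemma pt_le (ht : 0 < t) (h0 : 0 < lam) (h1 : lam < 1) (n : ℕ) :
    |pt lam t 1 n| ≤ ((n : ℝ) + 1) / sig0 t := by
  unfold pt
  have h2 := sig0_pos ht
  have h3 := sdev_ge ht h0 h1
  rw [abs_div, abs_of_pos (h2.trans_le h3), Nat.cast_one, one_mul]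
  have := abs_sub_beta ht h1 n
  gcongr

lemma law_int (ht : 0 < t) (h0 : 0 < lam) (h1 : lam < 1) {f : ℝ → ℝ}
    {c : ℝ} (hf : ∀ n, |f (pt lam t 1 n)| ≤ c * ((n : ℝ) + 1) ^ 3) :
    Integrable f (law lam t) := by
  unfold law
  refine integrable_sum_dirac (by simp) ?_
  have := summable_of_dom ht h0 h1 (f := fun n => |f (pt lam t 1 n)|) (c := c) (by simpa using hf)
  refine this.congr fun n => ?_
  rw [ENNReal.toReal_ofReal (p_nonneg ht h0 h1 n), Real.norm_eq_abs]

lemma law_integral (ht : 0 < t) (h0 : 0 < lam) (h1 : lam < 1) (f : ℝ → ℝ) :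
    ∫ x, f x ∂(law lam t) = ∑' n, pTKF lam t n * f (pt lam t 1 n) := by
  unfold law
  rw [integral_sum_dirac (by simp)]
  refine tsum_congr fun n => ?_
  rw [ENNReal.toReal_ofReal (p_nonneg ht h0 h1 n), smul_eq_mul]

/-- third-moment bound -/
noncomputable def rho (t : ℝ) : ℝ := ∑' n : ℕ, dom t n * (((n : ℝ) + 1) / sig0 t) ^ 3

lemma pow_bound (ht : 0 < t) (h0 : 0 < lam) (h1 : lam < 1) (k : ℕ) (hk : k ≤ 3) (n : ℕ) :
    |pt lam t 1 n| ^ k ≤ (1 / sig0 t) ^ k * ((n : ℝ) + 1) ^ 3 := by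
  have hs := sig0_pos ht
  calc |pt lam t 1 n| ^ k ≤ (((n : ℝ) + 1) / sig0 t) ^ k :=
        pow_le_pow_left₀ (abs_nonneg _) (pt_le ht h0 h1 n) k
    _ = (1 / sig0 t) ^ k * ((n : ℝ) + 1) ^ k := by rw [← mul_pow]; congr 1; ring
    _ ≤ _ := by
      gcongr
      linarith [(Nat.cast_nonneg n : (0:ℝ) ≤ n)]

lemma law_mom (ht : 0 < t) (h0 : 0 < lam) (h1 : lam < 1) : Mom (law lam t) (rho t) where
  int3 := law_int ht h0 h1 (c := (1 / sig0 t) ^ 3) fun n => by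
    simpa using pow_bound ht h0 h1 3 le_rfl n
  int2 := law_int ht h0 h1 (c := (1 / sig0 t) ^ 2) fun n => by
    rw [abs_pow]; exact pow_bound ht h0 h1 2 (by norm_num) n
  int1 := law_int ht h0 h1 (c := (1 / sig0 t) ^ 1) fun n => by
    rw [← pow_one |_|]; exact pow_bound ht h0 h1 1 (by norm_num) n
  mean := by
    rw [law_integral ht h0 h1]
    obtain ⟨a, b⟩ := tsum_p ht h0 h1
    obtain ⟨c, d⟩ := tsum_np ht h0 h1
    have e : ∀ n : ℕ, pTKF lam t n * pt lam t 1 n =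
        (pTKF lam t n * n - pTKF lam t n * betaTKF lam t) / sdev lam t := fun n => by
      unfold pt; push_cast; ring
    simp_rw [e]
    rw [tsum_div_const, c.tsum_sub (a.mul_right _), tsum_mul_right, b, d]
    simp
  var := by
    rw [law_integral ht h0 h1]
    have hs := (sig0_pos ht).trans_le (sdev_ge ht h0 h1)
    have e : ∀ n : ℕ, pTKF lam t n * pt lam t 1 n ^ 2 =
        (((n : ℝ) - betaTKF lam t) ^ 2 * pTKF lam t n) / sdev lam t ^ 2 := fun n => by
      unfold pt; push_cast; ring
    simp_rw [e]
    rw [tsum_div_const, ← sdev_sq ht h0 h1, div_self (by positivity)]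
  third := by
    rw [law_integral ht h0 h1]
    have hs := sig0_pos ht
    have hdom : Summable fun n : ℕ => dom t n * (((n : ℝ) + 1) / sig0 t) ^ 3 := by
      refine ((summable_dom ht).div_const (sig0 t ^ 3)).congr fun n => ?_
      rw [div_pow]; ring
    refine Summable.tsum_le_tsum (fun n => ?_)
      (summable_of_dom ht h0 h1 (c := (1 / sig0 t) ^ 3) fun n => ?_) hdom
    · have h2 := p_nonneg ht h0 h1 n
      have h3 := p_le_dom ht h0 h1 n
      have h4 := pt_le ht h0 h1 n
      have h5 := h2.trans h3
      gcongr
    · simpa using pow_bound ht h0 h1 3 le_rfl n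

lemma pS_nonneg (ht : 0 < t) (h0 : 0 < lam) (h1 : lam < 1) (M n : ℕ) : 0 ≤ pS lam t M n := by
  induction M generalizing n with
  | zero => simp only [pS]; split_ifs <;> norm_num
  | succ M ih =>
    exact Finset.sum_nonneg fun k _ => mul_nonneg (ih k) (p_nonneg ht h0 h1 _)

lemma pt_add (lam t : ℝ) (M k j : ℕ) : pt lam t M k + pt lam t 1 j = pt lam t (M + 1) (k + j) := by
  unfold pt; push_cast; ring

lemma lintegral_cp (ht : 0 < t) (h0 : 0 < lam) (h1 : lam < 1) (M : ℕ) {f : ℝ → ℝ≥0∞}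
    (hf : Measurable f) :
    ∫⁻ x, f x ∂(cp (law lam t) M) = ∑' n, ENNReal.ofReal (pS lam t M n) * f (pt lam t M n) := by
  haveI := law_prob ht h0 h1
  induction M generalizing f with
  | zero =>
    rw [cp, lintegral_dirac, tsum_eq_single 0]
    · simp [pS, pt]
    · intro n hn; simp [pS, hn]
  | succ M ih =>
    have hl : ∀ g : ℝ → ℝ≥0∞, ∫⁻ y, g y ∂(law lam t) =
        ∑' j, ENNReal.ofReal (pTKF lam t j) * g (pt lam t 1 j) := fun g => by
      simp [law, lintegral_sum_measure]
    have hm : Measurable fun x => ∫⁻ y, f (x + y) ∂(law lam t) :=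
      Measurable.lintegral_prod_right' (f := fun p : ℝ × ℝ => f (p.1 + p.2)) (by fun_prop)
    rw [cp, Measure.lintegral_conv hf, ih hm]
    simp_rw [hl, ← ENNReal.tsum_mul_left]
    rw [← ENNReal.tsum_prod, ← Finset.HasAntidiagonal.sigmaAntidiagonalEquivProd.tsum_eq,
      ENNReal.tsum_sigma']
    refine tsum_congr fun n => ?_
    rw [tsum_fintype, Finset.univ_eq_attach]
    simp only [Finset.HasAntidiagonal.sigmaAntidiagonalEquivProd_apply]
    rw [Finset.sum_attach (Finset.HasAntidiagonal.antidiagonal n) (fun p : ℕ × ℕ =>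
      ENNReal.ofReal (pS lam t M p.1) * (ENNReal.ofReal (pTKF lam t p.2) *
        f (pt lam t M p.1 + pt lam t 1 p.2)))]
    have e : pS lam t (M + 1) n =
        ∑ p ∈ Finset.HasAntidiagonal.antidiagonal n, pS lam t M p.1 * pTKF lam t p.2 := by
      rw [Finset.Nat.sum_antidiagonal_eq_sum_range_succ_mk]
      rfl
    rw [e, ENNReal.ofReal_sum_of_nonneg
      (fun p _ => mul_nonneg (pS_nonneg ht h0 h1 _ _) (p_nonneg ht h0 h1 _)), Finset.sum_mul]
    refine Finset.sum_congr rfl fun p hp => ?_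
    rw [pt_add, Finset.HasAntidiagonal.mem_antidiagonal.1 hp, ENNReal.ofReal_mul (pS_nonneg ht h0 h1 _ _), mul_assoc]

lemma cdfS_eq (ht : 0 < t) (h0 : 0 < lam) (h1 : lam < 1) (M : ℕ) (y : ℝ) :
    cdfS lam t M (M * betaTKF lam t + y * sdev lam t) = F (cp (law lam t) M) y := by
  have hs := (sig0_pos ht).trans_le (sdev_ge ht h0 h1)
  unfold F Measure.real cdfS
  rw [← lintegral_indicator_one measurableSet_Iic,
    lintegral_cp ht h0 h1 M (measurable_one.indicator measurableSet_Iic), ENNReal.tsum_toReal_eq]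
  · refine tsum_congr fun n => ?_
    have : ((n : ℝ) ≤ M * betaTKF lam t + y * sdev lam t) ↔ pt lam t M n ≤ y := by
      unfold pt
      rw [div_le_iff₀ hs]
      constructor <;> intro h <;> linarith
    simp only [this, indicator, mem_Iic, Pi.one_apply]
    split_ifs
    · rw [mul_one, ENNReal.toReal_ofReal (pS_nonneg ht h0 h1 _ _)]
    · simp
  · intro n
    simp only [indicator]
    split_ifs <;> simp

end tkf

end BE

/-- Berry–Esséen-type bound for `S_M(λ,t)`, uniform in `λ ∈ [λ*,1)`. -/
theorem berry_esseen_uniform (t lamstar : ℝ) (ht : 0 < t)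
    (hl : lamstar ∈ Set.Ioo (0 : ℝ) 1) :
    ∃ C : ℝ, 0 < C ∧ ∀ M : ℕ, 1 ≤ M → ∀ lam ∈ Set.Ico lamstar (1 : ℝ), ∀ x : ℝ,
      |cdfS lam t M ((M : ℝ) * betaTKF lam t + x * sdev lam t * Real.sqrt M) -
          stdNormalCDF x| ≤ C / Real.sqrt M := by
  obtain ⟨C, hC, h⟩ := BE.berry_esseen (BE.rho t)
  refine ⟨C, hC, fun M hM lam hlam x => ?_⟩
  have h0 : 0 < lam := hl.1.trans_le hlam.1
  have h1 : lam < 1 := hlam.2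
  haveI := BE.law_prob ht h0 h1
  have hs := BE.sqrt_pos' hM
  have key := h (BE.law lam t) (BE.law_mom ht h0 h1) M (x * Real.sqrt M)
  rw [← BE.cdfS_eq ht h0 h1, BE.F_gam M hM, mul_div_cancel_right₀ _ hs.ne'] at key
  rw [show x * sdev lam t * Real.sqrt M = x * Real.sqrt M * sdev lam t by ring]
  exact key
end
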